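/- arXiv:1504.00168 — 7 statements merged into one kernel-verified Lean document; each statement's English description precedes it below -/
import Mathlib

section
/- Let $M$ and its $\mathfrak m$-adic completion $\widehat M$ both be totally separated $R$-modules and let $X$ be a finitely generated $R$-module. Then the embedding $M \subseteq \widehat M$ induces an isomorphism $\widehat{X \otimes_R M} \to X \otimes_R \widehat M$ between the $\mathfrak m$-adic completion of $X \otimes_R M$ and $X \otimes_R \widehat M$. -/
/- Throughout, `(R, 𝔪)` is a commutative noetherian local ring and all modules are `R`-modules.
`AdicCompletion (maximalIdeal R) M` is the `𝔪`-adic completion `lim M/𝔪^n M` and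
`IsHausdorff (maximalIdeal R) M` says that `M` is (`𝔪`-adically) separated. -/

open TensorProduct IsLocalRing

universe u

section Definitions

variable (R : Type u) [CommRing R]

/-- A linear map is a *pure monomorphism* if it is injective and remains injective after
tensoring with an arbitrary module. -/
def IsPureMono {M N : Type u} [AddCommGroup M] [Module R M] [AddCommGroup N] [Module R N]
    (f : M →ₗ[R] N) : Prop :=
  Function.Injective f ∧
    ∀ (X : Type u) [AddCommGroup X] [Module R X], Function.Injective (LinearMap.lTensor X f)

/-- A module `N` is *pure-injective* if every pure monomorphism out of `N` splits. -/
def IsPureInjective (N : Type u) [AddCommGroup N] [Module R N] : Prop :=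
  ∀ (Y : Type u) [AddCommGroup Y] [Module R Y] (f : N →ₗ[R] Y),
    IsPureMono R f → ∃ g : Y →ₗ[R] N, g ∘ₗ f = LinearMap.id

/-- A submodule `A ⊆ B` is *pure* if its inclusion is a pure monomorphism. -/
def IsPureSubmodule {B : Type u} [AddCommGroup B] [Module R B] (A : Submodule R B) : Prop :=
  IsPureMono R A.subtype

/-- An extension `A ⊆ B` is *pure-essential* if `A` is pure in `B` and for every submodule
`X ⊆ B` with `X ⊓ A = 0` such that `(X ⊕ A)/X` is pure in `B/X`, one has `X = 0`. -/
def IsPureEssential {B : Type u} [AddCommGroup B] [Module R B] (A : Submodule R B) : Prop :=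
  IsPureSubmodule R A ∧
    ∀ X : Submodule R B, X ⊓ A = ⊥ → IsPureMono R (X.mkQ ∘ₗ A.subtype) → X = ⊥

/-- An extension `A ⊆ B` is *strictly pure-essential* if it is pure-essential and for every
extension `B ⊆ Y` in which `A` is pure in `Y`, also `B` is pure in `Y`. -/
def IsStrictlyPureEssential {B : Type u} [AddCommGroup B] [Module R B] (A : Submodule R B) :
    Prop :=
  IsPureEssential R A ∧
    ∀ (Y : Type u) [AddCommGroup Y] [Module R Y] (g : B →ₗ[R] Y),
      Function.Injective g → IsPureMono R (g ∘ₗ A.subtype) → IsPureMono R g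

/-- A module `M` over a local ring is *totally separated* if `X ⊗[R] M` is `𝔪`-adically
separated for every finitely generated `R`-module `X`. -/
def IsTotallySeparatedModule [IsLocalRing R] (M : Type u) [AddCommGroup M] [Module R M] :
    Prop :=
  ∀ (X : Type u) [AddCommGroup X] [Module R X] [Module.Finite R X],
    IsHausdorff (maximalIdeal R) (X ⊗[R] M)

end Definitions

namespace AdicCompletion

variable {R : Type*} [CommRing R] (I : Ideal R)
  (X M : Type*) [AddCommGroup X] [Module R X] [AddCommGroup M] [Module R M]

/-- The canonical map `X ⊗ M^ → (X ⊗ M)^`. -/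
noncomputable def tensorComparison :
    X ⊗[R] AdicCompletion I M →ₗ[R] AdicCompletion I (X ⊗[R] M) :=
  TensorProduct.lift <| LinearMap.mk₂ R
    (fun x z ↦ map I (TensorProduct.mk R X M x) z)
    (fun x y z ↦ by
      induction z using AdicCompletion.induction_on
      ext n
      simp)
    (fun r x z ↦ by
      induction z using AdicCompletion.induction_on
      ext n
      simp [val_smul_apply])
    (fun x z w ↦ map_add _ z w)
    (fun r x z ↦ (map I (TensorProduct.mk R X M x)).map_smul_of_tower r z)

@[simp]
theorem tensorComparison_tmul (x : X) (z : AdicCompletion I M) :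
    tensorComparison I X M (x ⊗ₜ z) = map I (TensorProduct.mk R X M x) z :=
  rfl

theorem tensorComparison_comp_lTensor_of :
    tensorComparison I X M ∘ₗ LinearMap.lTensor X (of I M) = of I (X ⊗[R] M) := by
  ext x m : 3
  simp [map_of]

theorem tensorComparison_surjective [Module.Finite R X] :
    Function.Surjective (tensorComparison I X M) := by
  obtain ⟨n, x, hx⟩ := Module.Finite.exists_fin (R := R) (M := X)
  let p : (Fin n → M) →ₗ[R] X ⊗[R] M :=
    ∑ i, TensorProduct.mk R X M (x i) ∘ₗ LinearMap.proj i
  have hp : Function.Surjective p := by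
    rw [← LinearMap.range_eq_top, eq_top_iff, ← TensorProduct.span_tmul_eq_top,
      Submodule.span_le]
    rintro _ ⟨y, m, rfl⟩
    obtain ⟨c, rfl⟩ :=
      (Submodule.mem_span_range_iff_exists_fun R).1 (hx ▸ Submodule.mem_top (x := y))
    exact ⟨fun i ↦ c i • m, by simp [p, TensorProduct.sum_tmul, TensorProduct.smul_tmul]⟩
  intro y
  obtain ⟨z, rfl⟩ := map_surjective I hp y
  refine ⟨∑ i, x i ⊗ₜ map I (LinearMap.proj i) z, ?_⟩
  induction z using AdicCompletion.induction_on
  ext k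
  simp [p, val_sum_apply]

variable {I} in
/-- Modulo `I ^ n`, every tensor over the completion comes from a tensor over the module. -/
theorem exists_sub_lTensor_of_mem (hI : I.FG) (n : ℕ) (t : X ⊗[R] AdicCompletion I M) :
    ∃ s : X ⊗[R] M, t - LinearMap.lTensor X (of I M) s ∈
      (I ^ n • ⊤ : Submodule R (X ⊗[R] AdicCompletion I M)) := by
  induction t with
  | zero => exact ⟨0, by simp⟩
  | add t u ht hu =>
    obtain ⟨s, hs⟩ := ht
    obtain ⟨v, hv⟩ := hu
    exact ⟨s + v, by simpa [add_sub_add_comm] using add_mem hs hv⟩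
  | tmul x z =>
    obtain ⟨m, hm⟩ := Submodule.mkQ_surjective _ (eval I M n z)
    refine ⟨x ⊗ₜ m, ?_⟩
    have hz : z - of I M m ∈ (I ^ n • ⊤ : Submodule R (AdicCompletion I M)) := by
      rw [pow_smul_top_eq_ker_eval hI, LinearMap.mem_ker, map_sub, eval_of, hm, sub_self]
    rw [LinearMap.lTensor_tmul, ← TensorProduct.tmul_sub]
    exact Submodule.smul_top_le_comap_smul_top _
      (TensorProduct.mk R X (AdicCompletion I M) x) hz

variable {I} in
theorem tensorComparison_injective (hI : I.FG) [IsHausdorff I (X ⊗[R] AdicCompletion I M)] :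
    Function.Injective (tensorComparison I X M) := by
  rw [injective_iff_map_eq_zero]
  intro t ht
  refine IsHausdorff.haus ‹_› t fun n ↦ SModEq.zero.2 ?_
  obtain ⟨s, hs⟩ := exists_sub_lTensor_of_mem X M hI n t
  have hts := pow_smul_top_le_ker_eval I n
    (Submodule.smul_top_le_comap_smul_top _ (tensorComparison I X M) hs)
  rw [LinearMap.mem_ker, map_sub, ht, zero_sub, map_neg, neg_eq_zero,
    ← LinearMap.comp_apply (tensorComparison I X M), tensorComparison_comp_lTensor_of,
    eval_of, Submodule.mkQ_apply, Submodule.Quotient.mk_eq_zero] at hts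
  rw [← sub_add_cancel t (LinearMap.lTensor X (of I M) s)]
  exact add_mem hs (Submodule.smul_top_le_comap_smul_top _ (LinearMap.lTensor X (of I M)) hts)

end AdicCompletion

/-- If `M` and its completion `M^` are totally separated and `X` is finitely
generated, then the embedding `M ⊆ M^` induces an isomorphism `(X ⊗ M)^ → X ⊗ M^`,
i.e. there is an isomorphism commuting with the canonical maps out of `X ⊗ M`. -/
theorem completion_tensor_iso (R : Type u) [CommRing R] [IsNoetherianRing R] [IsLocalRing R]
    (M : Type u) [AddCommGroup M] [Module R M]
    (hM : IsTotallySeparatedModule R M)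
    (hMhat : IsTotallySeparatedModule R (AdicCompletion (maximalIdeal R) M))
    (X : Type u) [AddCommGroup X] [Module R X] [Module.Finite R X] :
    ∃ e : AdicCompletion (maximalIdeal R) (X ⊗[R] M) ≃ₗ[R]
        X ⊗[R] AdicCompletion (maximalIdeal R) M,
      e.toLinearMap ∘ₗ AdicCompletion.of (maximalIdeal R) (X ⊗[R] M) =
        LinearMap.lTensor X (AdicCompletion.of (maximalIdeal R) M) := by
  have := hMhat X
  let e := LinearEquiv.ofBijective (AdicCompletion.tensorComparison (maximalIdeal R) X M)
    ⟨AdicCompletion.tensorComparison_injective X M (maximalIdeal R).fg_of_isNoetherianRing,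
      AdicCompletion.tensorComparison_surjective (maximalIdeal R) X M⟩
  refine ⟨e.symm, ?_⟩
  rw [← AdicCompletion.tensorComparison_comp_lTensor_of, ← LinearMap.comp_assoc]
  exact congrArg (· ∘ₗ _) e.symm_comp
end

section
/- Every totally separated $R$-module $M$ is a pure submodule of its $\mathfrak m$-adic completion $\widehat M$, i.e. the canonical map $M \to \widehat M$ is a pure monomorphism. -/
/- Throughout, `(R, 𝔪)` is a commutative noetherian local ring and all modules are `R`-modules.
`AdicCompletion (maximalIdeal R) M` is the `𝔪`-adic completion `lim M/𝔪^n M` and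
`IsHausdorff (maximalIdeal R) M` says that `M` is (`𝔪`-adically) separated. -/

open TensorProduct IsLocalRing

universe u

/-- The image of `X ⊗ I • M` in `X ⊗ M` lies in `I • (X ⊗ M)`. -/
lemma LinearMap.range_lTensor_subtype_smul_top_le {R X M : Type*} [CommRing R] [AddCommGroup X]
    [Module R X] [AddCommGroup M] [Module R M] (I : Ideal R) :
    LinearMap.range (LinearMap.lTensor X (I • ⊤ : Submodule R M).subtype) ≤
      I • (⊤ : Submodule R (X ⊗[R] M)) := by
  rintro _ ⟨t, rfl⟩
  induction t with
  | zero => simp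
  | add a b ha hb => simpa only [map_add] using add_mem ha hb
  | tmul x m =>
    have h : I • (⊤ : Submodule R M) ≤
        (I • (⊤ : Submodule R (X ⊗[R] M))).comap (TensorProduct.mk R X M x) := by
      rw [← Submodule.map_le_iff_le_comap, Submodule.map_smul'']
      exact Submodule.smul_mono le_rfl le_top
    exact h m.2

/-- An element of `X ⊗ M` that dies in `X ⊗ (AdicCompletion I M)` is divisible by all powers
of `I`. -/
lemma AdicCompletion.mem_pow_smul_top_of_lTensor_of_eq_zero {R X M : Type*} [CommRing R]
    [AddCommGroup X] [Module R X] [AddCommGroup M] [Module R M] (I : Ideal R) {z : X ⊗[R] M}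
    (hz : LinearMap.lTensor X (AdicCompletion.of I M) z = 0) (n : ℕ) :
    z ∈ I ^ n • (⊤ : Submodule R (X ⊗[R] M)) := by
  apply LinearMap.range_lTensor_subtype_smul_top_le
  rw [← lTensor_mkQ, LinearMap.mem_ker, ← AdicCompletion.eval_comp_of,
    LinearMap.lTensor_comp_apply, hz, _root_.map_zero]

lemma AdicCompletion.lTensor_of_injective {R X M : Type*} [CommRing R]
    [AddCommGroup X] [Module R X] [AddCommGroup M] [Module R M] (I : Ideal R)
    [IsHausdorff I (X ⊗[R] M)] :
    Function.Injective (LinearMap.lTensor X (AdicCompletion.of I M)) :=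
  (injective_iff_map_eq_zero _).2 fun z hz ↦ IsHausdorff.haus ‹_› z fun n ↦
    SModEq.zero.2 (mem_pow_smul_top_of_lTensor_of_eq_zero I hz n)

/-- To check that a linear map stays injective after tensoring with `X`, it suffices to tensor
with the finitely generated submodules of `X`. -/
lemma LinearMap.lTensor_injective_of_forall_fg {R X M N : Type*} [CommRing R]
    [AddCommGroup X] [Module R X] [AddCommGroup M] [Module R M] [AddCommGroup N] [Module R N]
    (f : M →ₗ[R] N)
    (h : ∀ P : Submodule R X, P.FG → Function.Injective (LinearMap.lTensor P f)) :
    Function.Injective (LinearMap.lTensor X f) := by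
  rw [injective_iff_map_eq_zero]
  intro z hz
  obtain ⟨P, hP, y, rfl⟩ := Submodule.exists_fg_le_eq_rTensor_subtype z
  rw [← LinearMap.comp_apply, LinearMap.lTensor_comp_rTensor, ← LinearMap.rTensor_comp_lTensor,
    LinearMap.comp_apply] at hz
  obtain ⟨Q, hPQ, hQ, hz⟩ := TensorProduct.eq_zero_of_fg_of_subtype_eq_zero hP hz
  rw [← LinearMap.comp_apply, LinearMap.rTensor_comp_lTensor, ← LinearMap.lTensor_comp_rTensor,
    LinearMap.comp_apply] at hz
  rw [← Submodule.subtype_comp_inclusion P Q hPQ, LinearMap.rTensor_comp_apply,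
    (injective_iff_map_eq_zero _).1 (h Q hQ) _ hz, _root_.map_zero]

/-- Every totally separated module is pure in its `𝔪`-adic completion. -/
theorem totallySeparated_pure_in_completion (R : Type u) [CommRing R] [IsNoetherianRing R]
    [IsLocalRing R] (M : Type u) [AddCommGroup M] [Module R M]
    (hM : IsTotallySeparatedModule R M) :
    IsPureMono R (AdicCompletion.of (maximalIdeal R) M) := by
  have key (X : Type u) [AddCommGroup X] [Module R X] :
      Function.Injective (LinearMap.lTensor X (AdicCompletion.of (maximalIdeal R) M)) :=
    LinearMap.lTensor_injective_of_forall_fg _ fun P hP ↦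
      have := Module.Finite.iff_fg.2 hP
      have := hM P
      AdicCompletion.lTensor_of_injective _
  refine ⟨(injective_iff_map_eq_zero _).2 fun x hx ↦ ?_, fun X _ _ ↦ key X⟩
  have h : (1 : R) ⊗ₜ[R] x = 0 := (injective_iff_map_eq_zero _).1 (key R) _ (by simp [hx])
  simpa using congrArg (TensorProduct.lid R M) h
end

section
/- Let $M$ be a totally separated $R$-module whose $\mathfrak m$-adic completion $\widehat M$ is pure-injective, and let $X$ be a finitely generated $R$-module. Then the $\mathfrak m$-adic completion $\widehat{X \otimes_R M}$ is pure-injective. -/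
/- Throughout, `(R, 𝔪)` is a commutative noetherian local ring and all modules are `R`-modules.
`AdicCompletion (maximalIdeal R) M` is the `𝔪`-adic completion `lim M/𝔪^n M` and
`IsHausdorff (maximalIdeal R) M` says that `M` is (`𝔪`-adically) separated. -/

open TensorProduct IsLocalRing

universe u

section PureInjective

variable {R : Type u} [CommRing R]

theorem IsPureInjective.exists_extension {N : Type u} [AddCommGroup N] [Module R N]
    (hN : IsPureInjective R N) {A B : Type u} [AddCommGroup A] [Module R A]
    [AddCommGroup B] [Module R B] {f : A →ₗ[R] B} (hf : IsPureMono R f) (g : A →ₗ[R] N) :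
    ∃ h : B →ₗ[R] N, h ∘ₗ f = g := by
  let d : A →ₗ[R] N × B := LinearMap.prod g (-f)
  let P : Submodule R (N × B) := LinearMap.range d
  let i : N →ₗ[R] (N × B) ⧸ P := P.mkQ ∘ₗ LinearMap.inl R N B
  have hi : IsPureMono R i := by
    have key : ∀ (X : Type u) [AddCommGroup X] [Module R X],
        Function.Injective (LinearMap.lTensor X i) := by
      intro X _ _
      rw [injective_iff_map_eq_zero]
      intro t ht
      have hex : Function.Exact d P.mkQ := by
        rw [LinearMap.exact_iff]; simp [P]
      have hT := lTensor_exact X hex P.mkQ_surjective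
      rw [LinearMap.lTensor_comp, LinearMap.comp_apply] at ht
      obtain ⟨s, hs⟩ := (hT _).1 ht
      have h2 := congrArg (LinearMap.lTensor X (LinearMap.snd R N B)) hs
      simp only [← LinearMap.comp_apply, ← LinearMap.lTensor_comp] at h2
      have e1 : LinearMap.snd R N B ∘ₗ d = -f := by ext; simp [d]
      have e2 : LinearMap.snd R N B ∘ₗ LinearMap.inl R N B = 0 := by ext; simp
      rw [e1, e2, LinearMap.lTensor_neg, LinearMap.lTensor_zero, LinearMap.neg_apply,
        LinearMap.zero_apply, neg_eq_zero] at h2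
      have hs0 : s = 0 := (injective_iff_map_eq_zero _).1 (hf.2 X) s h2
      have h1 := congrArg (LinearMap.lTensor X (LinearMap.fst R N B)) hs
      simp only [← LinearMap.comp_apply, ← LinearMap.lTensor_comp] at h1
      have e3 : LinearMap.fst R N B ∘ₗ LinearMap.inl R N B = LinearMap.id := by ext; simp
      rw [e3, hs0, map_zero, LinearMap.lTensor_id, LinearMap.id_apply] at h1
      exact h1.symm
    refine ⟨?_, key⟩
    rw [injective_iff_map_eq_zero]
    intro x hx
    obtain ⟨a, ha⟩ := (Submodule.Quotient.mk_eq_zero P).1 hx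
    have h2 : f a = 0 := by simpa [d] using congrArg Prod.snd ha
    have ha0 : a = 0 := (injective_iff_map_eq_zero _).1 hf.1 a h2
    simpa [d, ha0] using (congrArg Prod.fst ha).symm
  obtain ⟨r, hr⟩ := hN _ i hi
  refine ⟨r ∘ₗ P.mkQ ∘ₗ LinearMap.inr R N B, ?_⟩
  ext a
  have h0 : P.mkQ (LinearMap.inr R N B (f a)) = P.mkQ (LinearMap.inl R N B (g a)) := by
    symm
    rw [← sub_eq_zero, ← map_sub]
    exact (Submodule.Quotient.mk_eq_zero P).2 ⟨a, by simp [d]⟩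
  have h1 : r (i (g a)) = g a := LinearMap.congr_fun hr (g a)
  simp only [LinearMap.comp_apply, h0]
  exact h1

theorem IsPureInjective.of_retract {N Q : Type u} [AddCommGroup N] [Module R N]
    [AddCommGroup Q] [Module R Q] (hN : IsPureInjective R N) (i : Q →ₗ[R] N) (r : N →ₗ[R] Q)
    (hri : r ∘ₗ i = LinearMap.id) : IsPureInjective R Q := by
  intro Y _ _ f hf
  obtain ⟨h, hh⟩ := hN.exists_extension hf i
  exact ⟨r ∘ₗ h, by rw [LinearMap.comp_assoc, hh, hri]⟩

/-- Character modules are pure-injective. -/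
theorem isPureInjective_characterModule (E : Type u) [AddCommGroup E] [Module R E] :
    IsPureInjective R (CharacterModule E) := by
  intro Y _ _ f hf
  have h : Function.Injective (f.rTensor E) :=
    (LinearMap.lTensor_inj_iff_rTensor_inj E f).1 (hf.2 E)
  obtain ⟨g, hg⟩ := rTensor_injective_iff_lcomp_surjective.1 h LinearMap.id
  exact ⟨g, hg⟩

/-- The evaluation map into the double character module. -/
noncomputable def characterEval (N : Type u) [AddCommGroup N] [Module R N] :
    N →ₗ[R] CharacterModule (CharacterModule N) where
  toFun x := (AddMonoidHom.mk' (fun c : CharacterModule N => c x) fun _ _ => rfl :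
    CharacterModule N →+ AddCircle (1 : ℚ))
  map_add' x y := by ext c; exact map_add c x y
  map_smul' r x := by ext c; rfl

theorem isPureMono_characterEval (N : Type u) [AddCommGroup N] [Module R N] :
    IsPureMono R (characterEval (R := R) N) := by
  constructor
  · rw [injective_iff_map_eq_zero]
    intro x hx
    exact CharacterModule.eq_zero_of_character_apply fun c => DFunLike.congr_fun hx c
  · intro X _ _
    rw [injective_iff_map_eq_zero]
    intro t ht
    refine CharacterModule.eq_zero_of_character_apply fun c => ?_
    let h : X →ₗ[R] CharacterModule N := CharacterModule.homEquiv.symm c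
    let h' : X →ₗ[R] CharacterModule (CharacterModule (CharacterModule N)) :=
      characterEval (CharacterModule N) ∘ₗ h
    have key : ∀ t : X ⊗[R] N,
        CharacterModule.homEquiv h' (LinearMap.lTensor X (characterEval N) t) = c t := by
      intro t
      induction t using TensorProduct.induction_on with
      | zero => simp only [map_zero]
      | add a b ha hb => simp only [map_add, ha, hb]
      | tmul x n => rfl
    rw [← key, ht, map_zero]

/-- The map `N^ι → N^κ` given by a matrix of scalars. -/
def scalarMatrixMap {ι κ : Type} [Fintype ι] (a : κ → ι → R) (N : Type u) [AddCommGroup N]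
    [Module R N] : (ι → N) →ₗ[R] (κ → N) :=
  LinearMap.pi fun k => ∑ i, a k i • LinearMap.proj i

@[simp]
theorem scalarMatrixMap_apply {ι κ : Type} [Fintype ι] (a : κ → ι → R) (N : Type u)
    [AddCommGroup N] [Module R N] (y : ι → N) (k : κ) :
    scalarMatrixMap a N y k = ∑ i, a k i • y i := by
  simp [scalarMatrixMap]

theorem map_scalarMatrixMap {ι κ : Type} [Fintype ι] (a : κ → ι → R) {N P : Type u}
    [AddCommGroup N] [Module R N] [AddCommGroup P] [Module R P] (f : N →ₗ[R] P) (y : ι → N) :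
    (fun k => f (scalarMatrixMap a N y k)) = scalarMatrixMap a P (fun i => f (y i)) := by
  ext k
  simp

theorem exists_characterModule_presentation {ι κ : Type} [Fintype ι] [Fintype κ]
    (a : κ → ι → R) (E : Type u) [AddCommGroup E] [Module R E] :
    ∃ (K : Type u) (_ : AddCommGroup K) (_ : Module R K)
      (q : (κ → CharacterModule E) →ₗ[R] CharacterModule K), Function.Surjective q ∧
      LinearMap.ker q = LinearMap.range (scalarMatrixMap a (CharacterModule E)) := by
  classical
  let b : (κ → E) →ₗ[R] (ι → E) := scalarMatrixMap (fun i k => a k i) E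
  let e (τ : Type) [Fintype τ] : (τ → CharacterModule E) →ₗ[R] CharacterModule (τ → E) :=
    ∑ t, CharacterModule.dual (LinearMap.proj t) ∘ₗ LinearMap.proj t
  have he (τ : Type) [Fintype τ] (φ : τ → CharacterModule E) (x : τ → E) :
      e τ φ x = ∑ t, φ t (x t) := by
    simp only [e, LinearMap.sum_apply]
    have hs : ∀ (s : Finset τ) (F : τ → CharacterModule (τ → E)),
        (∑ t ∈ s, F t) x = ∑ t ∈ s, F t x := by
      intro s F
      exact map_sum (characterEval (R := R) (τ → E) x : _ →+ AddCircle (1 : ℚ)) F s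
    rw [hs]
    rfl
  have hsurj (τ : Type) [Fintype τ] [DecidableEq τ] : Function.Surjective (e τ) := by
    intro χ
    refine ⟨fun t => CharacterModule.dual (LinearMap.single R (fun _ => E) t) χ, ?_⟩
    ext x
    rw [he]
    conv_rhs => rw [← Finset.univ_sum_single x, map_sum]
    rfl
  have hinj (τ : Type) [Fintype τ] [DecidableEq τ] : Function.Injective (e τ) := by
    rw [injective_iff_map_eq_zero]
    intro φ hφ
    ext t x
    have := DFunLike.congr_fun hφ (Pi.single t x)
    rw [he, Finset.sum_eq_single t] at this
    · rwa [Pi.single_eq_same] at this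
    · intro u _ hu
      rw [Pi.single_eq_of_ne hu, map_zero]
    · simp
  have hcomm (ψ : ι → CharacterModule E) :
      e κ (scalarMatrixMap a _ ψ) = CharacterModule.dual b (e ι ψ) := by
    ext x
    have h1 : CharacterModule.dual b (e ι ψ) x = e ι ψ (b x) := rfl
    rw [h1, he, he]
    have h2 (k : κ) : scalarMatrixMap a _ ψ k (x k) = ∑ i, ψ i (a k i • x k) := by
      rw [scalarMatrixMap_apply]
      exact map_sum (characterEval (R := R) E (x k) : _ →+ AddCircle (1 : ℚ))
        (fun i => a k i • ψ i) Finset.univ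
    rw [Finset.sum_congr rfl fun k _ => h2 k, Finset.sum_comm]
    simp only [b, scalarMatrixMap_apply, map_sum]
  refine ⟨LinearMap.ker b, inferInstance, inferInstance,
    CharacterModule.dual (LinearMap.ker b).subtype ∘ₗ e κ, ?_, ?_⟩
  · exact (CharacterModule.dual_surjective_of_injective _
      (LinearMap.ker b).injective_subtype).comp (hsurj κ)
  · apply le_antisymm
    · intro φ hφ
      have h0 : ∀ x : κ → E, b x = 0 → e κ φ x = 0 := fun x hx =>
        DFunLike.congr_fun (show CharacterModule.dual (LinearMap.ker b).subtype (e κ φ) = 0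
          from hφ) ⟨x, hx⟩
      let χ : CharacterModule ((κ → E) ⧸ LinearMap.ker b) :=
        QuotientAddGroup.lift (LinearMap.ker b).toAddSubgroup
          (e κ φ : (κ → E) →+ AddCircle (1 : ℚ)) h0
      let b' := (LinearMap.ker b).liftQ b le_rfl
      have hb' : Function.Injective b' := by
        rw [← LinearMap.ker_eq_bot]
        exact Submodule.ker_liftQ_eq_bot _ _ _ le_rfl
      obtain ⟨ψ, hψ⟩ := CharacterModule.dual_surjective_of_injective b' hb' χ
      obtain ⟨y, rfl⟩ := hsurj ι ψ
      refine ⟨y, hinj κ ?_⟩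
      rw [hcomm]
      ext x
      exact DFunLike.congr_fun hψ (Submodule.Quotient.mk x)
    · rintro _ ⟨ψ, rfl⟩
      rw [LinearMap.mem_ker, LinearMap.comp_apply, hcomm]
      ext ⟨x, hx⟩
      change e ι ψ (b x) = 0
      rw [show b x = 0 from hx, map_zero]

/-- The cokernel of a scalar matrix acting on a pure-injective module is pure-injective. -/
theorem IsPureInjective.of_presentation {ι κ : Type} [Fintype ι] [Fintype κ]
    (a : κ → ι → R) {N Q : Type u} [AddCommGroup N] [Module R N] [AddCommGroup Q] [Module R Q]
    (hN : IsPureInjective R N) (q : (κ → N) →ₗ[R] Q) (hq : Function.Surjective q)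
    (hker : LinearMap.ker q = LinearMap.range (scalarMatrixMap a N)) :
    IsPureInjective R Q := by
  obtain ⟨r, hr⟩ := hN _ _ (isPureMono_characterEval N)
  obtain ⟨K, _, _, p, hp, hpker⟩ :=
    exists_characterModule_presentation a (CharacterModule N)
  have induce {A B C D : Type u} [AddCommGroup A] [Module R A] [AddCommGroup B] [Module R B]
      [AddCommGroup C] [Module R C] [AddCommGroup D] [Module R D] (f : A →ₗ[R] B)
      (α : (κ → A) →ₗ[R] C) (hα : Function.Surjective α)
      (hαk : LinearMap.ker α = LinearMap.range (scalarMatrixMap a A))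
      (β : (κ → B) →ₗ[R] D) (hβk : LinearMap.ker β = LinearMap.range (scalarMatrixMap a B)) :
      ∃ g : C →ₗ[R] D, ∀ v, g (α v) = β (fun k => f (v k)) := by
    let F : (κ → A) →ₗ[R] (κ → B) := LinearMap.pi fun k => f ∘ₗ LinearMap.proj k
    have hle : LinearMap.ker α ≤ LinearMap.ker (β ∘ₗ F) := by
      rw [hαk]
      rintro _ ⟨y, rfl⟩
      rw [LinearMap.mem_ker, LinearMap.comp_apply, ← LinearMap.mem_ker, hβk]
      exact ⟨fun i => f (y i), (map_scalarMatrixMap a f y).symm⟩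
    refine ⟨(LinearMap.ker α).liftQ (β ∘ₗ F) hle ∘ₗ
      (α.quotKerEquivOfSurjective hα).symm.toLinearMap, fun v => ?_⟩
    have : (α.quotKerEquivOfSurjective hα).symm (α v) = Submodule.Quotient.mk v := by
      rw [LinearEquiv.symm_apply_eq]; rfl
    simp only [LinearMap.comp_apply, LinearEquiv.coe_coe, this]
    rfl
  obtain ⟨i', hi'⟩ := induce (characterEval N) q hq hker p hpker
  obtain ⟨r', hr'⟩ := induce r p hp hpker q hker
  refine (isPureInjective_characterModule K).of_retract i' r' ?_
  ext z
  obtain ⟨v, rfl⟩ := hq z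
  rw [LinearMap.comp_apply, hi', hr', LinearMap.id_apply]
  congr 1
  ext k
  exact LinearMap.congr_fun hr (v k)

theorem isPureMono_lcoeFun (N : Type u) [AddCommGroup N] [Module R N] :
    IsPureMono R (Finsupp.lcoeFun : (ℕ →₀ N) →ₗ[R] (ℕ → N)) := by
  refine ⟨DFunLike.coe_injective, fun X _ _ => ?_⟩
  rw [injective_iff_map_eq_zero]
  intro t ht
  have key : ∀ t : X ⊗[R] (ℕ →₀ N), ∀ n, TensorProduct.finsuppRight R R X N ℕ t n =
      LinearMap.lTensor X (LinearMap.proj n) (LinearMap.lTensor X Finsupp.lcoeFun t) := by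
    intro t n
    induction t using TensorProduct.induction_on with
    | zero => simp
    | add x y hx hy => simp only [map_add, Finsupp.add_apply, hx, hy]
    | tmul x f => simp [TensorProduct.finsuppRight_apply_tmul_apply, Finsupp.lcoeFun]
  rw [← map_eq_zero_iff _ (TensorProduct.finsuppRight R R X N ℕ).injective]
  ext n
  rw [key, ht, map_zero, Finsupp.zero_apply]

/-- A pure-injective module admits a linear infinite summation. -/
theorem IsPureInjective.exists_summation {N : Type u} [AddCommGroup N] [Module R N]
    (hN : IsPureInjective R N) :
    ∃ s : (ℕ → N) →ₗ[R] N, ∀ k x, s (Pi.single k x) = x := by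
  obtain ⟨s, hs⟩ := hN.exists_extension (isPureMono_lcoeFun N)
    (Finsupp.lsum ℕ fun _ => LinearMap.id)
  refine ⟨s, fun k x => ?_⟩
  have := LinearMap.congr_fun hs (Finsupp.single k x)
  simpa [Finsupp.lcoeFun, Finsupp.single_eq_pi_single] using this

theorem exists_sum_of_mem_smul_top {N : Type u} [AddCommGroup N] [Module R N] {n : ℕ}
    (g : Fin n → R) {x : N} (hx : x ∈ (Ideal.span (Set.range g) • ⊤ : Submodule R N)) :
    ∃ c : Fin n → N, x = ∑ i, g i • c i := by
  rw [Submodule.span_smul_eq] at hx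
  induction x, hx using Submodule.set_smul_inductionOn with
  | @smul₀ r y hr _ =>
    obtain ⟨i, rfl⟩ := hr
    exact ⟨Pi.single i y, by simp [Pi.single_apply]⟩
  | smul₁ r _ h =>
    obtain ⟨c, rfl⟩ := h
    exact ⟨r • c, by simp [Finset.smul_sum, smul_comm r]⟩
  | add _ _ h₁ h₂ =>
    obtain ⟨c, rfl⟩ := h₁
    obtain ⟨d, rfl⟩ := h₂
    exact ⟨c + d, by simp [Finset.sum_add_distrib]⟩
  | zero => exact ⟨0, by simp⟩

theorem map_mem_smul_top_of_forall_mem {N P : Type u} [AddCommGroup N] [Module R N]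
    [AddCommGroup P] [Module R P] (s : (ℕ → N) →ₗ[R] P) {J : Ideal R} (hJ : J.FG) {w : ℕ → N}
    (hw : ∀ k, w k ∈ (J • ⊤ : Submodule R N)) : s w ∈ (J • ⊤ : Submodule R P) := by
  obtain ⟨n, g, rfl⟩ := Submodule.fg_iff_exists_fin_generating_family.1 hJ
  choose c hc using fun k => exists_sum_of_mem_smul_top g (hw k)
  have : w = ∑ i, g i • fun k => c k i := by
    ext k
    simp [hc k]
  rw [this, map_sum]
  refine Submodule.sum_mem _ fun i _ => ?_
  rw [map_smul]
  exact Submodule.smul_mem_smul (Submodule.subset_span ⟨i, rfl⟩) trivial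

/-- The image of a scalar matrix acting on a separated pure-injective module is closed. -/
theorem IsPureInjective.mem_range_scalarMatrixMap {ι κ : Type} [Fintype ι]
    (a : κ → ι → R) {N : Type u} [AddCommGroup N] [Module R N] (hN : IsPureInjective R N)
    {I : Ideal R} (hI : I.FG) [IsHausdorff I N] {v : κ → N}
    (hv : ∀ n : ℕ, ∃ y, ∀ j, v j - scalarMatrixMap a N y j ∈ (I ^ n • ⊤ : Submodule R N)) :
    v ∈ LinearMap.range (scalarMatrixMap a N) := by
  obtain ⟨s, hs⟩ := hN.exists_summation
  choose y hy using hv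
  let Y : ι → N := fun i => y 0 i + s fun k => y (k + 1) i - y k i
  refine ⟨Y, funext fun j => ?_⟩
  let z : ℕ → N := fun k => scalarMatrixMap a N (y (k + 1)) j - scalarMatrixMap a N (y k) j
  have hz (k : ℕ) : z k ∈ (I ^ k • ⊤ : Submodule R N) := by
    have h1 := hy k j
    have h2 : v j - scalarMatrixMap a N (y (k + 1)) j ∈ (I ^ k • ⊤ : Submodule R N) :=
      Submodule.smul_mono_left (Ideal.pow_le_pow_right k.le_succ) (hy (k + 1) j)
    have := Submodule.sub_mem _ h1 h2
    rwa [sub_sub_sub_cancel_left] at this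
  have hY : scalarMatrixMap a N Y j = scalarMatrixMap a N (y 0) j + s z := by
    have hz' : z = ∑ i, a j i • fun k => y (k + 1) i - y k i := by
      ext k
      simp [z, smul_sub]
    rw [hz', map_sum]
    simp [Y, Finset.sum_add_distrib]
  rw [← sub_eq_zero]
  refine IsHausdorff.haus ‹IsHausdorff I N› _ fun K => ?_
  rw [SModEq.zero, hY]
  let tail : ℕ → N := fun k => if k < K then 0 else z k
  have htail : s tail ∈ (I ^ K • ⊤ : Submodule R N) := by
    refine map_mem_smul_top_of_forall_mem s (Ideal.FG.pow hI) fun k => ?_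
    by_cases hk : k < K
    · simp [tail, hk]
    · simpa [tail, hk] using
        Submodule.smul_mono_left (Ideal.pow_le_pow_right (not_lt.1 hk)) (hz k)
  have hzs : z = ∑ k ∈ Finset.range K, Pi.single k (z k) + tail := by
    ext l
    simp only [Pi.add_apply, Finset.sum_apply, Finset.sum_pi_single, Finset.mem_range, tail]
    split_ifs <;> simp
  have hsz : s z = scalarMatrixMap a N (y K) j - scalarMatrixMap a N (y 0) j + s tail := by
    conv_lhs => rw [hzs]
    simp only [map_add, map_sum, hs]
    rw [Finset.sum_range_sub fun k => scalarMatrixMap a N (y k) j]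
  have hfin := Submodule.sub_mem _ htail (hy K j)
  rw [hsz]
  convert hfin using 1
  abel

/-- Tensoring a finite presentation of `X` presents `X ⊗ N` by a scalar matrix. -/
theorem exists_tensor_presentation [IsNoetherianRing R] (X : Type u) [AddCommGroup X]
    [Module R X] [Module.Finite R X] (N : Type u) [AddCommGroup N] [Module R N] :
    ∃ (m n : ℕ) (a : Fin n → Fin m → R) (p : (Fin n → N) →ₗ[R] X ⊗[R] N),
      Function.Surjective p ∧ LinearMap.ker p = LinearMap.range (scalarMatrixMap a N) := by
  obtain ⟨n, f, hf⟩ := Module.Finite.exists_fin' R X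
  obtain ⟨m, g, hg⟩ := Module.Finite.exists_fin' R (LinearMap.ker f)
  let G : (Fin m → R) →ₗ[R] (Fin n → R) := (LinearMap.ker f).subtype ∘ₗ g
  have hG : Function.Exact G f := by
    rw [LinearMap.exact_iff, LinearMap.range_comp, LinearMap.range_eq_top.2 hg]
    simp
  let e (k : ℕ) : (Fin k → R) ⊗[R] N ≃ₗ[R] (Fin k → N) :=
    TensorProduct.comm R _ _ ≪≫ₗ TensorProduct.piScalarRight R R N (Fin k)
  let a : Fin n → Fin m → R := fun j i => G (Pi.single i 1) j
  have hcomm : scalarMatrixMap a N ∘ₗ (e m).toLinearMap =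
      (e n).toLinearMap ∘ₗ LinearMap.rTensor N G := by
    refine TensorProduct.ext' fun v x => ?_
    ext j
    have : G v j = ∑ i, v i * a j i := by
      conv_lhs => rw [pi_eq_sum_univ' v]
      simp [a]
    simp only [LinearMap.comp_apply, LinearMap.rTensor_tmul, e, LinearEquiv.coe_coe,
      LinearEquiv.trans_apply, TensorProduct.comm_tmul, TensorProduct.piScalarRight_apply,
      TensorProduct.piScalarRightHom_tmul, scalarMatrixMap_apply, this, Finset.sum_smul,
      smul_smul, mul_comm]
  have hex := rTensor_exact N hG hf
  refine ⟨m, n, a, LinearMap.rTensor N f ∘ₗ (e n).symm.toLinearMap,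
    (LinearMap.rTensor_surjective N hf).comp (e n).symm.surjective, ?_⟩
  ext v
  rw [LinearMap.mem_ker, LinearMap.comp_apply]
  refine (hex _).trans ⟨?_, ?_⟩
  · rintro ⟨t, ht⟩
    refine ⟨e m t, ?_⟩
    have := LinearMap.congr_fun hcomm t
    simp only [LinearMap.comp_apply, ht] at this
    simpa using this
  · rintro ⟨y, rfl⟩
    refine ⟨(e m).symm y, (e n).injective ?_⟩
    have := LinearMap.congr_fun hcomm ((e m).symm y)
    simpa using this.symm

/-- A finite scalar-matrix presentation of `T` over `M` yields one of the completion of `T` over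
the completion of `M`, provided the latter is pure-injective. -/
theorem exists_adicCompletion_presentation {ι κ : Type} [Fintype ι] [Fintype κ]
    (a : κ → ι → R) {M T : Type u} [AddCommGroup M] [Module R M] [AddCommGroup T] [Module R T]
    {I : Ideal R} (hI : I.FG) (hM : IsPureInjective R (AdicCompletion I M))
    (p : (κ → M) →ₗ[R] T) (hp : Function.Surjective p)
    (hker : LinearMap.ker p = LinearMap.range (scalarMatrixMap a M)) :
    ∃ q : (κ → AdicCompletion I M) →ₗ[R] AdicCompletion I T, Function.Surjective q ∧
      LinearMap.ker q = LinearMap.range (scalarMatrixMap a (AdicCompletion I M)) := by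
  classical
  let q : (κ → AdicCompletion I M) →ₗ[R] AdicCompletion I T :=
    ∑ j, (AdicCompletion.map I (p ∘ₗ LinearMap.single R (fun _ => M) j)).restrictScalars R ∘ₗ
      LinearMap.proj j
  have hlift (τ : Type) (n : ℕ) (v : τ → AdicCompletion I M) :
      ∃ u : τ → M, ∀ j, AdicCompletion.eval I M n (v j) = Submodule.mkQ _ (u j) := by
    choose u hu using fun j => Submodule.mkQ_surjective _ (AdicCompletion.eval I M n (v j))
    exact ⟨u, fun j => (hu j).symm⟩
  have hq (n : ℕ) (v : κ → AdicCompletion I M) (u : κ → M)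
      (h : ∀ j, AdicCompletion.eval I M n (v j) = Submodule.mkQ _ (u j)) :
      AdicCompletion.eval I T n (q v) = Submodule.mkQ _ (p u) := by
    have hu : p u = ∑ j, p (Pi.single j (u j)) := by
      rw [← map_sum, Finset.univ_sum_single]
    rw [hu, map_sum]
    simp only [q, LinearMap.sum_apply, map_sum]
    refine Finset.sum_congr rfl fun j _ => ?_
    have h' := h j
    rw [AdicCompletion.eval_apply] at h'
    simp [AdicCompletion.map_val_apply, h']
  have hA (n : ℕ) (y : ι → AdicCompletion I M) (u : ι → M)
      (h : ∀ i, AdicCompletion.eval I M n (y i) = Submodule.mkQ _ (u i)) (j : κ) :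
      AdicCompletion.eval I M n (scalarMatrixMap a _ y j) =
        Submodule.mkQ _ (scalarMatrixMap a M u j) := by
    simp only [scalarMatrixMap_apply, map_sum, map_smul, h]
  refine ⟨q, fun t => ?_, le_antisymm (fun v hv => ?_) ?_⟩
  · obtain ⟨x, rfl⟩ := AdicCompletion.map_surjective I hp t
    refine ⟨fun j => AdicCompletion.map I (LinearMap.proj j) x, ?_⟩
    ext n
    obtain ⟨u, hu⟩ := Submodule.mkQ_surjective _ (AdicCompletion.eval I _ n x)
    rw [AdicCompletion.eval_apply] at hu
    have := hq n (fun j => AdicCompletion.map I (LinearMap.proj j) x) u fun j => by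
      simp [AdicCompletion.map_val_apply, ← hu]
    rw [AdicCompletion.eval_apply] at this
    rw [this, AdicCompletion.map_val_apply, ← hu]
    simp
  · refine hM.mem_range_scalarMatrixMap a hI fun n => ?_
    obtain ⟨u, hu⟩ := hlift κ n v
    have h0 := hq n v u hu
    rw [LinearMap.mem_ker.1 hv, map_zero, eq_comm, Submodule.mkQ_apply,
      Submodule.Quotient.mk_eq_zero, ← LinearMap.range_eq_top.2 hp, LinearMap.range_eq_map,
      ← Submodule.map_smul''] at h0
    obtain ⟨w, hw, hwu⟩ := h0
    have hmem : u - w ∈ LinearMap.ker p := by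
      rw [LinearMap.mem_ker, map_sub, hwu, sub_self]
    rw [hker] at hmem
    obtain ⟨y, hy⟩ := hmem
    refine ⟨fun i => AdicCompletion.of I M (y i), fun j => ?_⟩
    rw [AdicCompletion.pow_smul_top_eq_ker_eval hI, LinearMap.mem_ker, map_sub, hu,
      hA n _ y (fun i => rfl), hy, ← map_sub]
    simp only [Pi.sub_apply, sub_sub_cancel]
    rw [Submodule.mkQ_apply, Submodule.Quotient.mk_eq_zero]
    have := Submodule.mem_map_of_mem (f := LinearMap.proj (R := R) (φ := fun _ : κ => M) j) hw
    rw [Submodule.map_smul''] at this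
    exact Submodule.smul_mono le_rfl le_top this
  · rintro _ ⟨y, rfl⟩
    rw [LinearMap.mem_ker]
    ext n
    obtain ⟨u, hu⟩ := hlift ι n y
    have h0 : p (scalarMatrixMap a M u) = 0 := by
      rw [← LinearMap.mem_ker, hker]
      exact ⟨u, rfl⟩
    have := hq n _ _ (hA n y u hu)
    rw [h0, map_zero] at this
    exact this

end PureInjective

/-- If `M` is totally separated with pure-injective completion and `X` is
finitely generated, then the completion of `X ⊗ M` is pure-injective. -/
theorem completion_tensor_pureInjective (R : Type u) [CommRing R] [IsNoetherianRing R]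
    [IsLocalRing R] (M : Type u) [AddCommGroup M] [Module R M]
    (hM : IsTotallySeparatedModule R M)
    (hMhat : IsPureInjective R (AdicCompletion (maximalIdeal R) M))
    (X : Type u) [AddCommGroup X] [Module R X] [Module.Finite R X] :
    IsPureInjective R (AdicCompletion (maximalIdeal R) (X ⊗[R] M)) := by
  obtain ⟨m, n, a, p, hp, hker⟩ := exists_tensor_presentation (R := R) X M
  obtain ⟨q, hq, hqker⟩ := exists_adicCompletion_presentation a
    (IsNoetherian.noetherian (maximalIdeal R)) hMhat p hp hker
  exact hMhat.of_presentation a q hq hqker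
end

section
/- Let $X$ be a finitely generated $R$-module and $I$ an arbitrary index set. Then the $\mathfrak m$-adic completion $\widehat{X^{(I)}}$ of the direct sum $X^{(I)} = \bigoplus_{i\in I} X$ is a pure-injective $R$-module. -/
/- Throughout, `(R, 𝔪)` is a commutative noetherian local ring and all modules are `R`-modules.
`AdicCompletion (maximalIdeal R) M` is the `𝔪`-adic completion `lim M/𝔪^n M` and
`IsHausdorff (maximalIdeal R) M` says that `M` is (`𝔪`-adically) separated. -/

open TensorProduct IsLocalRing

universe u

section InjectiveHull

variable {R : Type*} [CommRing R] {M : Type*} [AddCommGroup M] [Module R M]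

/-- Every submodule disjoint from `A` is contained in a maximal one. -/
theorem Submodule.exists_le_maximal_disjoint {A B : Submodule R M} (h : Disjoint A B) :
    ∃ C, B ≤ C ∧ Maximal (Disjoint A) C := by
  refine zorn_le_nonempty₀ {C | Disjoint A C} (fun c hc hchain y hy => ?_) B h
  refine ⟨sSup c, ?_, fun z hz => le_sSup hz⟩
  exact (hchain.directedOn.disjoint_sSup_right).2 fun b hb => hc hb

/-- A retract of a module satisfying Baer's criterion satisfies it. -/
theorem Module.Baer.of_retract {N : Type*} [AddCommGroup N] [Module R N] (hM : Module.Baer R M)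
    (i : N →ₗ[R] M) (r : M →ₗ[R] N) (h : ∀ x, r (i x) = x) : Module.Baer R N := by
  intro I g
  obtain ⟨g', hg'⟩ := hM I (i ∘ₗ g)
  exact ⟨r ∘ₗ g', fun x hx => by simp [hg' x hx, h]⟩

/-- A submodule of an injective module has an essential extension that is injective. -/
theorem Module.Baer.exists_essential_extension (hM : Module.Baer R M) (K : Submodule R M) :
    ∃ E : Submodule R M, K ≤ E ∧ Module.Baer R E ∧ ∀ T ≤ E, Disjoint K T → T = ⊥ := by
  obtain ⟨C, -, hC⟩ := Submodule.exists_le_maximal_disjoint (disjoint_bot_right (a := K))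
  obtain ⟨E, hKE, hE⟩ := Submodule.exists_le_maximal_disjoint hC.prop.symm
  have hmax : ∀ W, C ≤ W → Disjoint E W → W = C := fun W h1 h2 =>
    le_antisymm (hC.2 (h2.mono_left hKE) h1) h1
  refine ⟨E, hKE, ?_, fun T hTE hT => ?_⟩
  · obtain ⟨h, hh⟩ := hM.extension_property (C.mkQ ∘ₗ E.subtype) (by
      rw [← LinearMap.ker_eq_bot, LinearMap.ker_comp, Submodule.ker_mkQ,
        ← Submodule.disjoint_iff_comap_eq_bot]
      exact hE.prop.symm) E.subtype
    have hh' : ∀ e ∈ E, h (C.mkQ e) = e := fun e he => LinearMap.congr_fun hh ⟨e, he⟩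
    have hV : C.comap (h ∘ₗ C.mkQ) = C := by
      refine hmax _ (fun c hc => ?_) ?_
      · have : C.mkQ c = 0 := by simpa using hc
        simp [Submodule.mem_comap, LinearMap.comp_apply, this]
      · rw [Submodule.disjoint_def]
        intro e he hec
        rw [Submodule.mem_comap, LinearMap.comp_apply, hh' e he] at hec
        exact Submodule.disjoint_def.1 hE.prop e hec he
    have hr : LinearMap.range h ≤ E := by
      refine hE.2 ?_ fun e he => ⟨_, hh' e he⟩
      rw [Submodule.disjoint_def]
      rintro _ hy ⟨z, rfl⟩
      obtain ⟨z, rfl⟩ := C.mkQ_surjective z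
      have : z ∈ C.comap (h ∘ₗ C.mkQ) := hy
      rw [hV] at this
      rw [show C.mkQ z = 0 by simpa using this, map_zero]
    exact hM.of_retract E.subtype
      ((h ∘ₗ C.mkQ).codRestrict E fun x => hr ⟨_, rfl⟩) fun x => Subtype.ext (hh' x x.2)
  · have h1 : C ⊔ T = C := by
      refine le_antisymm (hC.2 ?_ le_sup_left) le_sup_left
      rw [Submodule.disjoint_def]
      intro x hx hx'
      obtain ⟨c, hc, t, ht, rfl⟩ := Submodule.mem_sup.1 hx'
      have hcE : c ∈ E := by simpa using E.sub_mem (hKE hx) (hTE ht)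
      obtain rfl : c = 0 := Submodule.disjoint_def.1 hE.prop c hc hcE
      rw [zero_add] at hx ⊢
      exact Submodule.disjoint_def.1 hT t hx ht
    exact le_bot_iff.1 (hE.prop (sup_eq_left.1 h1) hTE)

/-- Over a noetherian ring, direct sums of copies of an injective module are injective. -/
theorem Module.Baer.finsupp [IsNoetherianRing R] (hM : Module.Baer R M) (ι : Type*) :
    Module.Baer R (ι →₀ M) := by
  classical
  intro I g
  choose G hG using fun i => hM I (Finsupp.lapply i ∘ₗ g)
  obtain ⟨s, hs⟩ := (inferInstance : Module.Finite R I).fg_top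
  let S : Finset ι := s.biUnion fun x => (g x).support
  have hS : ∀ x, ∀ i ∉ S, g x i = 0 := by
    intro x i hi
    have : (⊤ : Submodule R I) ≤ LinearMap.ker (Finsupp.lapply i ∘ₗ g) := by
      rw [← hs, Submodule.span_le]
      intro y hy
      by_contra hne
      exact hi (Finset.mem_biUnion.2 ⟨y, hy, Finsupp.mem_support_iff.2 hne⟩)
    exact this (Submodule.mem_top (x := x))
  refine ⟨∑ i ∈ S, Finsupp.lsingle i ∘ₗ G i, fun x hx => ?_⟩
  ext j
  simp only [LinearMap.sum_apply, LinearMap.comp_apply, hG _ x hx, Finsupp.lsingle_apply,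
    Finsupp.lapply_apply, Finsupp.finsetSum_apply, Finsupp.single_apply, Finset.sum_ite_eq']
  split_ifs with h
  · rfl
  · exact (hS _ j h).symm

end InjectiveHull

section Matlis

variable (R : Type*) [CommRing R] [IsLocalRing R]

/-- `E` is injective and its socle is generated by a single nonzero element; for a noetherian
local ring `R` this says that the socle of the injective module `E` is the residue field. -/
structure IsResidueInjective (E : Type*) [AddCommGroup E] [Module R E] : Prop where
  baer : Module.Baer R E
  exists_socle_generator : ∃ e₀ : E, e₀ ≠ 0 ∧ (∀ r ∈ maximalIdeal R, r • e₀ = 0) ∧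
    ∀ e : E, (∀ r ∈ maximalIdeal R, r • e = 0) → ∃ r : R, e = r • e₀

theorem exists_isResidueInjective (R : Type u) [CommRing R] [IsLocalRing R] :
    ∃ (E : Type u) (_ : AddCommGroup E) (_ : Module R E), IsResidueInjective R E := by
  let p : CategoryTheory.InjectivePresentation (ModuleCat.of R (ResidueField R)) :=
    (CategoryTheory.EnoughInjectives.presentation _).some
  have hJ : Module.Baer R p.J := Module.Baer.of_injective
    ((Module.injective_iff_injective_object R p.J).2 (by exact p.injective))
  have hf : Function.Injective p.f := (ModuleCat.mono_iff_injective _).1 p.mono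
  let f : ResidueField R →ₗ[R] p.J := p.f.hom
  have hf : Function.Injective f := hf
  have hm : ∀ r ∈ maximalIdeal R, r • f 1 = 0 := by
    intro r hr
    rw [← map_smul, Algebra.smul_def, mul_one, ResidueField.algebraMap_eq,
      (residue_eq_zero_iff r).2 hr, map_zero]
  obtain ⟨E, hKE, hE, hess⟩ := hJ.exists_essential_extension (Submodule.span R {f 1})
  refine ⟨E, inferInstance, inferInstance, hE,
    ⟨f 1, hKE (Submodule.mem_span_singleton_self _)⟩, ?_, ?_, ?_⟩
  · intro h
    have : f 1 = 0 := congrArg Subtype.val h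
    exact one_ne_zero (hf (this.trans (map_zero f).symm))
  · exact fun r hr => Subtype.ext (hm r hr)
  · rintro ⟨e, heE⟩ he
    have he' : ∀ r ∈ maximalIdeal R, r • e = 0 := fun r hr => congrArg Subtype.val (he r hr)
    by_cases h0 : e = 0
    · exact ⟨0, Subtype.ext (by simpa using h0)⟩
    have hnd : ¬ Disjoint (Submodule.span R {f 1}) (Submodule.span R {e}) := fun hd =>
      h0 (Submodule.span_singleton_eq_bot.1
        (hess _ ((Submodule.span_singleton_le_iff_mem _ _).2 heE) hd))
    rw [Submodule.disjoint_def] at hnd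
    push Not at hnd
    obtain ⟨x, hx1, hx2, hx⟩ := hnd
    obtain ⟨s, rfl⟩ := Submodule.mem_span_singleton.1 hx1
    obtain ⟨r, hr⟩ := Submodule.mem_span_singleton.1 hx2
    have hu : IsUnit r := by
      by_contra hn
      exact hx (hr ▸ he' r hn)
    obtain ⟨u, rfl⟩ := hu
    refine ⟨↑u⁻¹ * s, Subtype.ext ?_⟩
    change e = (↑u⁻¹ * s) • f 1
    rw [mul_smul, ← hr, smul_smul, Units.inv_mul, one_smul]

variable {R} {E : Type*} [AddCommGroup E] [Module R E] {L : Type*} [AddCommGroup L] [Module R L]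
  {ι : Type*}

/-- Linear maps to a residue-injective module separate points. -/
theorem IsResidueInjective.exists_apply_ne_zero (hE : IsResidueInjective R E) {x : L}
    (hx : x ≠ 0) : ∃ φ : L →ₗ[R] E, φ x ≠ 0 := by
  obtain ⟨e₀, h0, hm, -⟩ := hE.exists_socle_generator
  let t := LinearMap.toSpanSingleton R L x
  have hle : LinearMap.ker t ≤ LinearMap.ker (LinearMap.toSpanSingleton R E e₀) := by
    intro r hr
    refine hm r (le_maximalIdeal (fun h => hx ?_) hr)
    have : (1 : R) ∈ LinearMap.ker t := h ▸ Submodule.mem_top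
    simpa [t] using this
  obtain ⟨h, hh⟩ := hE.baer.extension_property ((LinearMap.ker t).liftQ t le_rfl)
    (LinearMap.ker_eq_bot.1 (Submodule.ker_liftQ_eq_bot _ _ _ le_rfl))
    ((LinearMap.ker t).liftQ _ hle)
  refine ⟨h, ?_⟩
  have h1 : h ((1 : R) • x) = (1 : R) • e₀ := LinearMap.congr_fun hh ((LinearMap.ker t).mkQ 1)
  rw [one_smul, one_smul] at h1
  rwa [h1]

theorem IsResidueInjective.finsupp_eq_zero (hE : IsResidueInjective R E) {x : ι →₀ L}
    (h : ∀ φ : L →ₗ[R] E, Finsupp.mapRange.linearMap φ x = 0) : x = 0 := by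
  ext i
  by_contra hx
  obtain ⟨φ, hφ⟩ := hE.exists_apply_ne_zero hx
  exact hφ (by simpa using DFunLike.congr_fun (h φ) i)

theorem IsResidueInjective.exists_eval_of_isSimpleModule (hE : IsResidueInjective R E)
    [IsSimpleModule R L] (Φ : (L →ₗ[R] E) →ₗ[R] (ι →₀ E)) :
    ∃ x : ι →₀ L, ∀ φ, Φ φ = Finsupp.mapRange.linearMap φ x := by
  obtain ⟨e₀, h0, hm, hs⟩ := hE.exists_socle_generator
  have := IsSimpleModule.nontrivial R L
  obtain ⟨l, hl⟩ := exists_ne (0 : L)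
  have hml : ∀ r ∈ maximalIdeal R, r • l = 0 := by
    intro r hr
    have := IsSimpleModule.ker_toSpanSingleton_isMaximal R hl
    rw [← eq_maximalIdeal this] at hr
    simpa using hr
  obtain ⟨φ₁, hφ₁⟩ := hE.exists_apply_ne_zero hl
  obtain ⟨c, hc⟩ := hs (φ₁ l) fun r hr => by rw [← map_smul, hml r hr, map_zero]
  have hcu : IsUnit c := by
    by_contra hn
    exact hφ₁ (hc.trans (hm c hn))
  obtain ⟨c, rfl⟩ := hcu
  have hφ0 : ∃ φ₀ : L →ₗ[R] E, φ₀ l = e₀ :=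
    ⟨(↑c⁻¹ : R) • φ₁, by rw [LinearMap.smul_apply, hc, smul_smul, Units.inv_mul, one_smul]⟩
  obtain ⟨φ₀, hφ₀⟩ := hφ0
  have hgen : ∀ φ : L →ₗ[R] E, ∃ r : R, φ = r • φ₀ := by
    intro φ
    obtain ⟨r, hr⟩ := hs (φ l) fun r hr => by rw [← map_smul, hml r hr, map_zero]
    refine ⟨r, LinearMap.ext fun y => ?_⟩
    obtain ⟨a, rfl⟩ := IsSimpleModule.toSpanSingleton_surjective R hl y
    simp only [LinearMap.toSpanSingleton_apply, map_smul, LinearMap.smul_apply, hφ₀, hr]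
  have hmφ : ∀ r ∈ maximalIdeal R, r • φ₀ = 0 := by
    intro r hr
    ext y
    obtain ⟨a, rfl⟩ := IsSimpleModule.toSpanSingleton_surjective R hl y
    simp [hφ₀, hm r hr]
  have hz : ∃ x : ι →₀ L, Φ φ₀ = Finsupp.mapRange.linearMap φ₀ x := by
    choose g hg using fun i => hs (Φ φ₀ i) fun r hr => by
      rw [← Finsupp.smul_apply, ← map_smul, hmφ r hr, map_zero, Finsupp.zero_apply]
    classical
    refine ⟨Finsupp.onFinset (Φ φ₀).support
      (fun i => if Φ φ₀ i = 0 then 0 else g i • l) fun i hi => ?_, ?_⟩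
    · simp only [ne_eq, ite_eq_left_iff, not_forall] at hi
      exact Finsupp.mem_support_iff.2 hi.1
    · ext i
      by_cases h : Φ φ₀ i = 0
      · simp [h]
      · simp [h, hφ₀, hg i |>.symm]
  obtain ⟨x, hx⟩ := hz
  refine ⟨x, fun φ => ?_⟩
  obtain ⟨r, rfl⟩ := hgen φ
  rw [map_smul, hx]
  ext i
  simp

/-- Matlis duality for modules of finite length, with coefficients in a direct sum. -/
theorem IsResidueInjective.exists_eval_of_isFiniteLength (hE : IsResidueInjective R E)
    (hL : IsFiniteLength R L) (Φ : (L →ₗ[R] E) →ₗ[R] (ι →₀ E)) :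
    ∃ x : ι →₀ L, ∀ φ, Φ φ = Finsupp.mapRange.linearMap φ x := by
  induction hL with
  | of_subsingleton =>
    refine ⟨0, fun φ => ?_⟩
    rw [Subsingleton.elim φ 0, map_zero, map_zero]
  | @of_simple_quotient M _ _ N _ _ ih =>
    obtain ⟨z, hz⟩ := hE.exists_eval_of_isSimpleModule (Φ ∘ₗ N.mkQ.lcomp R E)
    obtain ⟨w, rfl⟩ := Finsupp.mapRange_surjective N.mkQ (map_zero _) N.mkQ_surjective z
    let ev : (M →ₗ[R] E) →ₗ[R] (ι →₀ E) :=
      { toFun := fun φ => Finsupp.mapRange.linearMap φ w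
        map_add' := fun _ _ => by ext; simp
        map_smul' := fun _ _ => by ext; simp }
    have hker : LinearMap.ker (N.subtype.lcomp R E) ≤ LinearMap.ker (Φ - ev) := by
      intro φ hφ
      have hN : N ≤ LinearMap.ker φ := fun y hy => LinearMap.congr_fun hφ ⟨y, hy⟩
      have h := hz (N.liftQ φ hN)
      rw [LinearMap.mem_ker, LinearMap.sub_apply, sub_eq_zero]
      have h2 : N.mkQ.lcomp R E (N.liftQ φ hN) = φ := N.liftQ_mkQ φ hN
      rw [LinearMap.comp_apply, h2] at h
      rw [h]
      ext i
      simp [ev]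
    have hsurj : Function.Surjective (N.subtype.lcomp R E) := fun φ =>
      hE.baer.extension_property N.subtype N.subtype_injective φ
    let Ψ : (N →ₗ[R] E) →ₗ[R] (ι →₀ E) :=
      (LinearMap.ker (N.subtype.lcomp R E)).liftQ (Φ - ev) hker ∘ₗ
        ((N.subtype.lcomp R E).quotKerEquivOfSurjective hsurj).symm.toLinearMap
    obtain ⟨y, hy⟩ := ih Ψ
    refine ⟨w + Finsupp.mapRange.linearMap N.subtype y, fun φ => ?_⟩
    have h := hy (N.subtype.lcomp R E φ)
    have h2 : Ψ (N.subtype.lcomp R E φ) = Φ φ - ev φ := by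
      simp only [Ψ, LinearMap.comp_apply, LinearEquiv.coe_coe]
      rw [LinearMap.quotKerEquivOfSurjective_symm_apply]
      rfl
    rw [h2, sub_eq_iff_eq_add] at h
    rw [h, map_add, add_comm]
    congr 1
    ext i
    simp

end Matlis

theorem Finsupp.mem_ideal_smul_top_iff {R : Type*} [CommRing R] {M : Type*} [AddCommGroup M]
    [Module R M] {ι : Type*} (I : Ideal R) (w : ι →₀ M) :
    w ∈ (I • ⊤ : Submodule R (ι →₀ M)) ↔ ∀ i, w i ∈ (I • ⊤ : Submodule R M) := by
  constructor
  · intro hw i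
    have h : Finsupp.lapply i w ∈ (I • ⊤ : Submodule R (ι →₀ M)).map (Finsupp.lapply i) :=
      Submodule.mem_map_of_mem hw
    rw [Submodule.map_smul''] at h
    exact Submodule.smul_mono le_rfl le_top h
  · intro h
    rw [← Finsupp.sum_single w]
    refine Submodule.sum_mem _ fun i _ => ?_
    have h' : Finsupp.lsingle i (w i) ∈ (I • ⊤ : Submodule R M).map (Finsupp.lsingle i) :=
      Submodule.mem_map_of_mem (h i)
    rw [Submodule.map_smul''] at h'
    exact Submodule.smul_mono le_rfl le_top h'

theorem isFiniteLength_quotient_maximalIdeal_pow_smul_top (R : Type*) [CommRing R]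
    [IsNoetherianRing R] [IsLocalRing R] (M : Type*) [AddCommGroup M] [Module R M]
    [Module.Finite R M] (n : ℕ) :
    IsFiniteLength R (M ⧸ (maximalIdeal R ^ n • ⊤ : Submodule R M)) := by
  rw [isFiniteLength_iff_isNoetherian_isArtinian]
  refine ⟨inferInstance, ?_⟩
  rcases eq_or_ne n 0 with rfl | hn
  · have : Subsingleton (M ⧸ (maximalIdeal R ^ 0 • ⊤ : Submodule R M)) := by
      rw [Submodule.Quotient.subsingleton_iff]
      simp
    infer_instance
  have hne : maximalIdeal R ^ n ≠ ⊤ := fun h =>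
    (maximalIdeal.isMaximal R).ne_top (top_le_iff.1 (h ▸ Ideal.pow_le_self hn))
  have : Nontrivial (R ⧸ maximalIdeal R ^ n) := Ideal.Quotient.nontrivial_iff.2 hne
  have : IsLocalRing (R ⧸ maximalIdeal R ^ n) :=
    .of_surjective' (Ideal.Quotient.mk _) Ideal.Quotient.mk_surjective
  have : IsArtinianRing (R ⧸ maximalIdeal R ^ n) := by
    rw [isArtinianRing_iff_isNilpotent_maximalIdeal]
    refine ⟨n, ?_⟩
    have hmap : maximalIdeal (R ⧸ maximalIdeal R ^ n) ≤
        (maximalIdeal R).map (Ideal.Quotient.mk (maximalIdeal R ^ n)) := by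
      intro x hx
      obtain ⟨r, rfl⟩ := Ideal.Quotient.mk_surjective x
      exact Ideal.mem_map_of_mem _ fun hr => hx (hr.map _)
    refine le_bot_iff.1 ((Ideal.pow_right_mono hmap n).trans ?_)
    rw [← Ideal.map_pow, Ideal.map_quotient_self]
  have : Module.Finite (R ⧸ maximalIdeal R ^ n)
      (M ⧸ (maximalIdeal R ^ n • ⊤ : Submodule R M)) :=
    Module.Finite.of_restrictScalars_finite R _ _
  have : IsArtinian (R ⧸ maximalIdeal R ^ n)
      (M ⧸ (maximalIdeal R ^ n • ⊤ : Submodule R M)) := inferInstance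
  exact isArtinian_of_surjective_algebraMap (S := R) (R := R ⧸ maximalIdeal R ^ n)
    Ideal.Quotient.mk_surjective

section Pairing

variable {R : Type*} [CommRing R] (I : Ideal R) (X : Type*) [AddCommGroup X] [Module R X]
  (E : Type*) [AddCommGroup E] [Module R E] (ι : Type*)

/-- The linear maps `X → E` that vanish on some `I ^ n • X`. -/
def adicDual : Submodule R (X →ₗ[R] E) where
  carrier := {φ | ∃ n, (I ^ n • ⊤ : Submodule R X) ≤ LinearMap.ker φ}
  zero_mem' := ⟨0, by simp⟩
  add_mem' := by
    rintro φ ψ ⟨n, hn⟩ ⟨k, hk⟩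
    refine ⟨max n k, fun x hx => ?_⟩
    have h1 := hn (Submodule.smul_mono_left (Ideal.pow_le_pow_right (le_max_left n k)) hx)
    have h2 := hk (Submodule.smul_mono_left (Ideal.pow_le_pow_right (le_max_right n k)) hx)
    rw [LinearMap.mem_ker] at h1 h2 ⊢
    rw [LinearMap.add_apply, h1, h2, add_zero]
  smul_mem' := by
    rintro r φ ⟨n, hn⟩
    refine ⟨n, fun x hx => ?_⟩
    have h1 := hn hx
    rw [LinearMap.mem_ker] at h1 ⊢
    rw [LinearMap.smul_apply, h1, smul_zero]

variable {I X E ι}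

theorem mapRange_eq_of_mkQ_eq {φ : X →ₗ[R] E} {n : ℕ}
    (hφ : (I ^ n • ⊤ : Submodule R X) ≤ LinearMap.ker φ) {v w : ι →₀ X}
    (h : (I ^ n • ⊤ : Submodule R (ι →₀ X)).mkQ v = (I ^ n • ⊤ : Submodule R (ι →₀ X)).mkQ w) :
    Finsupp.mapRange.linearMap φ v = Finsupp.mapRange.linearMap φ w := by
  have h' := (Finsupp.mem_ideal_smul_top_iff _ _).1 ((Submodule.Quotient.eq _).1 h)
  ext i
  have := hφ (h' i)
  rw [LinearMap.mem_ker, Finsupp.sub_apply, map_sub, sub_eq_zero] at this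
  simpa using this

theorem AdicCompletion.mkQ_eq_val_of_le {M : Type*} [AddCommGroup M] [Module R M]
    (x : AdicCompletion I M) {n k : ℕ} (hnk : n ≤ k) {w : M}
    (hw : (I ^ k • ⊤ : Submodule R M).mkQ w = x.val k) :
    (I ^ n • ⊤ : Submodule R M).mkQ w = x.val n := by
  have h := x.2 hnk
  rw [← hw] at h
  exact h

theorem mapRange_eq_of_mkQ_eq_val {φ : X →ₗ[R] E} {n k : ℕ}
    (hn : (I ^ n • ⊤ : Submodule R X) ≤ LinearMap.ker φ)
    (hk : (I ^ k • ⊤ : Submodule R X) ≤ LinearMap.ker φ)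
    (x : AdicCompletion I (ι →₀ X)) {v w : ι →₀ X}
    (hv : (I ^ n • ⊤ : Submodule R (ι →₀ X)).mkQ v = x.val n)
    (hw : (I ^ k • ⊤ : Submodule R (ι →₀ X)).mkQ w = x.val k) :
    Finsupp.mapRange.linearMap φ v = Finsupp.mapRange.linearMap φ w := by
  rcases le_total n k with h | h
  · exact mapRange_eq_of_mkQ_eq hn (hv.trans (x.mkQ_eq_val_of_le h hw).symm)
  · exact mapRange_eq_of_mkQ_eq hk ((x.mkQ_eq_val_of_le h hv).trans hw.symm)

theorem exists_representative (φ : adicDual I X E) (x : AdicCompletion I (ι →₀ X)) :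
    ∃ (n : ℕ) (w : ι →₀ X), (I ^ n • ⊤ : Submodule R X) ≤ LinearMap.ker φ.1 ∧
      (I ^ n • ⊤ : Submodule R (ι →₀ X)).mkQ w = x.val n :=
  let ⟨n, hn⟩ := φ.2
  let ⟨w, hw⟩ := Submodule.mkQ_surjective _ (x.val n)
  ⟨n, w, hn, hw⟩

/-- Evaluation of a map vanishing on `I ^ n • X` at an element of the completion of `X^(ι)`. -/
noncomputable def adicEval (x : AdicCompletion I (ι →₀ X)) (φ : adicDual I X E) : ι →₀ E :=
  Finsupp.mapRange.linearMap φ.1 (exists_representative φ x).choose_spec.choose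

theorem adicEval_eq (x : AdicCompletion I (ι →₀ X)) (φ : adicDual I X E) {n : ℕ} {w : ι →₀ X}
    (hn : (I ^ n • ⊤ : Submodule R X) ≤ LinearMap.ker φ.1)
    (hw : (I ^ n • ⊤ : Submodule R (ι →₀ X)).mkQ w = x.val n) :
    adicEval x φ = Finsupp.mapRange.linearMap φ.1 w :=
  have h := (exists_representative φ x).choose_spec.choose_spec
  mapRange_eq_of_mkQ_eq_val h.1 hn x h.2 hw

variable (I X E ι)

/-- The pairing between the completion of `X^(ι)` and the maps vanishing on some `I ^ n • X`. -/
noncomputable def adicPairing :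
    AdicCompletion I (ι →₀ X) →ₗ[R] adicDual I X E →ₗ[R] (ι →₀ E) :=
  LinearMap.mk₂ R adicEval
    (fun x y φ => by
      obtain ⟨n, hn⟩ := φ.2
      obtain ⟨v, hv⟩ := Submodule.mkQ_surjective _ (x.val n)
      obtain ⟨w, hw⟩ := Submodule.mkQ_surjective _ (y.val n)
      rw [adicEval_eq x φ hn hv, adicEval_eq y φ hn hw, ← map_add]
      exact adicEval_eq _ φ hn (by rw [map_add, hv, hw]; rfl))
    (fun r x φ => by
      obtain ⟨n, hn⟩ := φ.2
      obtain ⟨v, hv⟩ := Submodule.mkQ_surjective _ (x.val n)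
      rw [adicEval_eq x φ hn hv, ← map_smul]
      exact adicEval_eq _ φ hn (by rw [map_smul, hv]; rfl))
    (fun x φ ψ => by
      obtain ⟨n, hn⟩ := φ.2
      obtain ⟨k, hk⟩ := ψ.2
      have hn' := (Submodule.smul_mono_left (N := (⊤ : Submodule R X))
        (Ideal.pow_le_pow_right (I := I) (le_max_left n k))).trans hn
      have hk' := (Submodule.smul_mono_left (N := (⊤ : Submodule R X))
        (Ideal.pow_le_pow_right (I := I) (le_max_right n k))).trans hk
      obtain ⟨v, hv⟩ := Submodule.mkQ_surjective _ (x.val (max n k))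
      rw [adicEval_eq x φ hn' hv, adicEval_eq x ψ hk' hv,
        adicEval_eq x (φ + ψ) (n := max n k) (fun y hy => ?_) hv]
      · ext
        simp
      · have h1 := hn' hy
        have h2 := hk' hy
        rw [LinearMap.mem_ker] at h1 h2 ⊢
        rw [Submodule.coe_add, LinearMap.add_apply, h1, h2, add_zero])
    (fun r x φ => by
      obtain ⟨n, hn⟩ := φ.2
      obtain ⟨v, hv⟩ := Submodule.mkQ_surjective _ (x.val n)
      rw [adicEval_eq x φ hn hv, adicEval_eq x (r • φ) (fun y hy => ?_) hv]
      · ext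
        simp
      · have h1 := hn hy
        rw [LinearMap.mem_ker] at h1 ⊢
        rw [Submodule.coe_smul, LinearMap.smul_apply, h1, smul_zero])

/-- Maps out of `X / I ^ n • X`, seen as maps out of `X` vanishing on `I ^ n • X`. -/
def adicDualOfQuotient (n : ℕ) :
    ((X ⧸ (I ^ n • ⊤ : Submodule R X)) →ₗ[R] E) →ₗ[R] adicDual I X E :=
  ((I ^ n • ⊤ : Submodule R X).mkQ.lcomp R E).codRestrict _ fun φ =>
    ⟨n, fun x hx => by
      have : (I ^ n • ⊤ : Submodule R X).mkQ x = 0 := by simpa using hx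
      rw [LinearMap.mem_ker, LinearMap.lcomp_apply, this, map_zero]⟩

variable {I X E ι}

theorem le_ker_adicDualOfQuotient {n : ℕ} (φ : (X ⧸ (I ^ n • ⊤ : Submodule R X)) →ₗ[R] E) :
    (I ^ n • ⊤ : Submodule R X) ≤ LinearMap.ker (adicDualOfQuotient I X E n φ).1 := fun x hx => by
  have : (I ^ n • ⊤ : Submodule R X).mkQ x = 0 := by simpa using hx
  change φ ((I ^ n • ⊤ : Submodule R X).mkQ x) = 0
  rw [this, map_zero]

theorem mapRange_adicDualOfQuotient {n : ℕ} (φ : (X ⧸ (I ^ n • ⊤ : Submodule R X)) →ₗ[R] E)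
    (w : ι →₀ X) :
    Finsupp.mapRange.linearMap (adicDualOfQuotient I X E n φ).1 w =
      Finsupp.mapRange.linearMap φ
        (Finsupp.mapRange.linearMap (I ^ n • ⊤ : Submodule R X).mkQ w) := by
  ext i
  simp only [Finsupp.mapRange.linearMap_apply, Finsupp.mapRange_apply]
  rfl

end Pairing

theorem IsResidueInjective.mkQ_eq_zero {R : Type*} [CommRing R] [IsLocalRing R] {I : Ideal R}
    {X : Type*} [AddCommGroup X] [Module R X] {E : Type*} [AddCommGroup E] [Module R E]
    {ι : Type*} (hE : IsResidueInjective R E) {n : ℕ} {w : ι →₀ X}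
    (h : ∀ φ, Finsupp.mapRange.linearMap (adicDualOfQuotient I X E n φ).1 w = 0) :
    (I ^ n • ⊤ : Submodule R (ι →₀ X)).mkQ w = 0 := by
  have h0 := hE.finsupp_eq_zero fun φ => (mapRange_adicDualOfQuotient φ w).symm.trans (h φ)
  rw [Submodule.mkQ_apply, Submodule.Quotient.mk_eq_zero, Finsupp.mem_ideal_smul_top_iff]
  intro i
  simpa using DFunLike.congr_fun h0 i

/-- The completion of `X^(ι)` is dual to the module of maps from `X` that vanish on some power of
the maximal ideal. -/
theorem IsResidueInjective.adicPairing_bijective {R : Type*} [CommRing R] [IsNoetherianRing R]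
    [IsLocalRing R] {X : Type*} [AddCommGroup X] [Module R X] [Module.Finite R X] {E : Type*}
    [AddCommGroup E] [Module R E] (hE : IsResidueInjective R E) (ι : Type*) :
    Function.Bijective (adicPairing (maximalIdeal R) X E ι) := by
  constructor
  · rw [← LinearMap.ker_eq_bot, LinearMap.ker_eq_bot']
    intro x hx
    refine AdicCompletion.ext fun n => ?_
    obtain ⟨w, hw⟩ := Submodule.mkQ_surjective _ (x.val n)
    rw [← hw]
    refine hE.mkQ_eq_zero fun φ => ?_
    rw [← adicEval_eq x _ (le_ker_adicDualOfQuotient φ) hw]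
    exact LinearMap.congr_fun hx _
  · intro Ψ
    have hrep : ∀ n, ∃ w : ι →₀ X, ∀ φ, Ψ (adicDualOfQuotient (maximalIdeal R) X E n φ) =
        Finsupp.mapRange.linearMap (adicDualOfQuotient (maximalIdeal R) X E n φ).1 w := by
      intro n
      obtain ⟨z, hz⟩ := hE.exists_eval_of_isFiniteLength
        (isFiniteLength_quotient_maximalIdeal_pow_smul_top R X n)
        (Ψ ∘ₗ adicDualOfQuotient (maximalIdeal R) X E n)
      obtain ⟨w, rfl⟩ := Finsupp.mapRange_surjective _ (map_zero _)
        (Submodule.mkQ_surjective (maximalIdeal R ^ n • ⊤ : Submodule R X)) z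
      exact ⟨w, fun φ => (hz φ).trans (mapRange_adicDualOfQuotient φ w).symm⟩
    choose w hw using hrep
    have hw' : ∀ (n : ℕ) (φ : adicDual (maximalIdeal R) X E),
        (maximalIdeal R ^ n • ⊤ : Submodule R X) ≤ LinearMap.ker φ.1 →
        Ψ φ = Finsupp.mapRange.linearMap φ.1 (w n) := by
      intro n φ hφ
      have : adicDualOfQuotient (maximalIdeal R) X E n (Submodule.liftQ _ φ.1 hφ) = φ :=
        Subtype.ext (Submodule.liftQ_mkQ _ φ.1 hφ)
      rw [← this]
      exact hw n _
    have hcompat : ∀ {n k : ℕ}, n ≤ k →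
        (maximalIdeal R ^ n • ⊤ : Submodule R (ι →₀ X)).mkQ (w k) =
        (maximalIdeal R ^ n • ⊤ : Submodule R (ι →₀ X)).mkQ (w n) := by
      intro n k hnk
      rw [← sub_eq_zero, ← map_sub]
      refine hE.mkQ_eq_zero fun φ => ?_
      have hφ := le_ker_adicDualOfQuotient φ
      rw [map_sub, sub_eq_zero, ← hw' n _ hφ, ← hw' k]
      exact (Submodule.smul_mono_left (Ideal.pow_le_pow_right hnk)).trans hφ
    let x : AdicCompletion (maximalIdeal R) (ι →₀ X) :=
      ⟨fun n => (maximalIdeal R ^ n • ⊤ : Submodule R (ι →₀ X)).mkQ (w n), fun hnk => hcompat hnk⟩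
    refine ⟨x, LinearMap.ext fun φ => ?_⟩
    obtain ⟨n, hn⟩ := φ.2
    rw [hw' n φ hn]
    exact adicEval_eq x φ hn rfl

/-- A module of linear maps into an injective module is pure-injective. -/
theorem IsPureInjective.of_bijective_to_injective {R : Type u} [CommRing R] {N A J : Type u}
    [AddCommGroup N] [Module R N] [AddCommGroup A] [Module R A] [AddCommGroup J] [Module R J]
    (hJ : Module.Baer R J) (c : N →ₗ[R] A →ₗ[R] J) (hc : Function.Bijective c) :
    IsPureInjective R N := by
  intro Y _ _ f hf
  obtain ⟨h, hh⟩ := hJ.extension_property (LinearMap.lTensor A f) (hf.2 A)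
    (TensorProduct.lift c.flip)
  let e := LinearEquiv.ofBijective c hc
  refine ⟨e.symm.toLinearMap ∘ₗ (TensorProduct.curry h).flip, LinearMap.ext fun x => ?_⟩
  change e.symm ((TensorProduct.curry h).flip (f x)) = x
  rw [LinearEquiv.symm_apply_eq]
  ext1 a
  exact LinearMap.congr_fun hh (a ⊗ₜ[R] x)

/-- For `X` finitely generated and any index set `ι`, the completion of the
direct sum `X^(ι)` is pure-injective. -/
theorem completion_directSum_pureInjective (R : Type u) [CommRing R] [IsNoetherianRing R]
    [IsLocalRing R] (X : Type u) [AddCommGroup X] [Module R X] [Module.Finite R X]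
    (ι : Type u) :
    IsPureInjective R (AdicCompletion (maximalIdeal R) (ι →₀ X)) := by
  obtain ⟨E, _, _, hE⟩ := exists_isResidueInjective R
  exact .of_bijective_to_injective (hE.baer.finsupp ι) _ (hE.adicPairing_bijective ι)
end

section
/- Let $B$ be a separated $R$-module and $A \subseteq B$ a submodule such that for all $n \ge 1$: $A \cap \mathfrak m^n B = \mathfrak m^n A$ and $B/(A + \mathfrak m^n B)$ is a free $R/\mathfrak m^n$-module. Then the induced map $\widehat A \to \widehat B$ of $\mathfrak m$-adic completions is a split monomorphism. -/
/- Throughout, `(R, 𝔪)` is a commutative noetherian local ring and all modules are `R`-modules.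
`AdicCompletion (maximalIdeal R) M` is the `𝔪`-adic completion `lim M/𝔪^n M` and
`IsHausdorff (maximalIdeal R) M` says that `M` is (`𝔪`-adically) separated. -/

open TensorProduct IsLocalRing

universe u

/-- A direct sum of copies of `R ⧸ J` is projective relative to modules killed by `J`. -/
theorem exists_lift_of_equiv_finsupp_quotient {R D X Y κ : Type*} [CommRing R] (J : Ideal R)
    [AddCommGroup D] [Module R D] [AddCommGroup X] [Module R X] [AddCommGroup Y] [Module R Y]
    (e : D ≃ₗ[R] (κ →₀ R ⧸ J)) (hX : ∀ r ∈ J, ∀ x : X, r • x = 0)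
    (p : X →ₗ[R] Y) (hp : Function.Surjective p) (h : D →ₗ[R] Y) :
    ∃ l : D →ₗ[R] X, p ∘ₗ l = h := by
  choose s hs using hp
  let φ : κ → (R ⧸ J) →ₗ[R] X := fun k =>
    Submodule.liftQ J
      (LinearMap.toSpanSingleton R X (s (h (e.symm (Finsupp.single k (Submodule.Quotient.mk 1))))))
      (fun r hr => by simpa using hX r hr _)
  have key : p ∘ₗ Finsupp.lsum R φ = h ∘ₗ e.symm.toLinearMap := by
    refine Finsupp.lhom_ext' fun k => Submodule.linearMap_qext _ (LinearMap.ext_ring ?_)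
    change p (Finsupp.lsum R φ (Finsupp.single k (Submodule.Quotient.mk 1))) =
      h (e.symm (Finsupp.single k (Submodule.Quotient.mk 1)))
    rw [Finsupp.lsum_single, Submodule.liftQ_apply, LinearMap.toSpanSingleton_apply, one_smul, hs]
  refine ⟨Finsupp.lsum R φ ∘ₗ e.toLinearMap, ?_⟩
  rw [← LinearMap.comp_assoc, key, LinearMap.comp_assoc]
  ext x
  simp

/-- A module of the form `M ⧸ J • ⊤` is killed by `J`. -/
theorem smul_quotient_smul_top_eq_zero {R M : Type*} [CommRing R] [AddCommGroup M] [Module R M]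
    (J : Ideal R) {r : R} (hr : r ∈ J) (x : M ⧸ (J • ⊤ : Submodule R M)) : r • x = 0 := by
  obtain ⟨x, rfl⟩ := Submodule.mkQ_surjective _ x
  rw [← map_smul, Submodule.mkQ_apply, Submodule.Quotient.mk_eq_zero]
  exact Submodule.smul_mem_smul hr Submodule.mem_top

section Retraction

variable {R B κ : Type*} [CommRing R] [AddCommGroup B] [Module R B] (A : Submodule R B)
  (J : Ideal R)

/-- If `A ∩ J B = J A` and `B ⧸ (A + J B)` is free over `R ⧸ J`, then `A ⧸ J A → B ⧸ J B` has a
retraction. -/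
theorem exists_mkQ_extension_of_inf_eq
    (hpure : A ⊓ (J • ⊤ : Submodule R B) = J • A)
    (e : (B ⧸ (A ⊔ (J • ⊤ : Submodule R B))) ≃ₗ[R] (κ →₀ R ⧸ J)) :
    ∃ g : B →ₗ[R] A ⧸ (J • ⊤ : Submodule R A),
      g ∘ₗ A.subtype = (J • ⊤ : Submodule R A).mkQ := by
  set p := Submodule.factor (le_sup_right : (J • ⊤ : Submodule R B) ≤ A ⊔ J • ⊤)
  have hmap : (J • ⊤ : Submodule R A).map A.subtype = J • A := by
    rw [Submodule.map_smul'', Submodule.map_subtype_top]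
  set f := A.subtype.reduceModIdeal J
  have hf : Function.Injective f := by
    rw [injective_iff_map_eq_zero]
    intro x hx
    obtain ⟨a, rfl⟩ := Submodule.mkQ_surjective _ x
    have ha : (a : B) ∈ (J • ⊤ : Submodule R B) := by
      simpa [f] using hx
    have ha' : (a : B) ∈ (J • ⊤ : Submodule R A).map A.subtype := by
      rw [hmap, ← hpure]
      exact ⟨a.2, ha⟩
    obtain ⟨a', h1, h2⟩ := ha'
    obtain rfl : a' = a := Subtype.ext h2
    simpa using h1
  have hfp : Function.Exact f p := by
    intro y
    obtain ⟨b, rfl⟩ := Submodule.mkQ_surjective _ y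
    constructor
    · intro hb
      have hb : b ∈ A ⊔ (J • ⊤ : Submodule R B) := by simpa [p] using hb
      obtain ⟨a, ha, c, hc, rfl⟩ := Submodule.mem_sup.1 hb
      refine ⟨Submodule.Quotient.mk ⟨a, ha⟩, ?_⟩
      simpa [f] using hc
    · rintro ⟨x, hx⟩
      obtain ⟨a, rfl⟩ := Submodule.mkQ_surjective _ x
      rw [← hx]
      simpa [p, f] using Submodule.mem_sup_left a.2
  obtain ⟨l, hl⟩ := ((hfp.split_tfae'.out 0 1 rfl rfl).1
    ⟨hf, exists_lift_of_equiv_finsupp_quotient J e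
      (fun r hr x => smul_quotient_smul_top_eq_zero J hr x) p
      (Submodule.factor_surjective _) LinearMap.id⟩).2
  refine ⟨l ∘ₗ Submodule.mkQ _, ?_⟩
  ext a
  simpa [f] using LinearMap.congr_fun hl (Submodule.Quotient.mk a)

/-- An extension of `A → A ⧸ J' A` to `B` lifts along `A ⧸ J A → A ⧸ J' A` to an extension of
`A → A ⧸ J A` when `A ⧸ J A → B ⧸ J B` is injective with cokernel free over `R ⧸ J`. -/
theorem exists_mkQ_extension_lift {J' : Ideal R} (hJ : (J • ⊤ : Submodule R A) ≤ J' • ⊤)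
    (hpure : A ⊓ (J • ⊤ : Submodule R B) = J • A)
    (e : (B ⧸ (A ⊔ (J • ⊤ : Submodule R B))) ≃ₗ[R] (κ →₀ R ⧸ J))
    (g : B →ₗ[R] A ⧸ (J' • ⊤ : Submodule R A))
    (hg : g ∘ₗ A.subtype = (J' • ⊤ : Submodule R A).mkQ) :
    ∃ g' : B →ₗ[R] A ⧸ (J • ⊤ : Submodule R A),
      g' ∘ₗ A.subtype = (J • ⊤ : Submodule R A).mkQ ∧ Submodule.factor hJ ∘ₗ g' = g := by
  obtain ⟨r, hr⟩ := exists_mkQ_extension_of_inf_eq A J hpure e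
  have hker : A ⊔ (J • ⊤ : Submodule R B) ≤
      LinearMap.ker (g - Submodule.factor hJ ∘ₗ r) := by
    refine sup_le (fun a ha => ?_) (Submodule.smul_le.2 fun c hc b _ => ?_)
    · have h1 := LinearMap.congr_fun hg ⟨a, ha⟩
      have h2 := LinearMap.congr_fun hr ⟨a, ha⟩
      simp only [LinearMap.comp_apply, Submodule.subtype_apply] at h1 h2
      simp [h1, h2]
    · obtain ⟨y, hy⟩ := Submodule.factor_surjective hJ ((g - Submodule.factor hJ ∘ₗ r) b)
      rw [LinearMap.mem_ker, map_smul, ← hy, ← map_smul, smul_quotient_smul_top_eq_zero J hc,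
        map_zero]
  obtain ⟨l, hl⟩ := exists_lift_of_equiv_finsupp_quotient J e
    (fun c hc x => smul_quotient_smul_top_eq_zero J hc x) (Submodule.factor hJ)
    (Submodule.factor_surjective hJ) (Submodule.liftQ _ _ hker)
  refine ⟨r + l ∘ₗ Submodule.mkQ _, ?_, ?_⟩
  · rw [LinearMap.add_comp, hr]
    ext a
    have : (Submodule.Quotient.mk (a : B) : B ⧸ (A ⊔ (J • ⊤ : Submodule R B))) = 0 := by
      rw [Submodule.Quotient.mk_eq_zero]
      exact Submodule.mem_sup_left a.2
    simp [this]
  · rw [LinearMap.comp_add, ← LinearMap.comp_assoc, hl, Submodule.liftQ_mkQ]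
    abel

end Retraction

/-- A compatible family of extensions of the maps `A → A ⧸ I ^ n A` to `B` induces a retraction of
the map on `I`-adic completions. -/
theorem AdicCompletion.exists_leftInverse_map_subtype {R B : Type*} [CommRing R] [AddCommGroup B]
    [Module R B] (I : Ideal R) (A : Submodule R B)
    (g : ∀ n : ℕ, B →ₗ[R] A ⧸ (I ^ n • ⊤ : Submodule R A))
    (hg : ∀ n, g n ∘ₗ A.subtype = (I ^ n • ⊤ : Submodule R A).mkQ)
    (hcomp : ∀ n, AdicCompletion.transitionMap I A n.le_succ ∘ₗ g (n + 1) = g n) :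
    ∃ l : AdicCompletion I B →ₗ[R] AdicCompletion I A,
      l ∘ₗ ((AdicCompletion.map I A.subtype).restrictScalars R) = LinearMap.id := by
  have hcomp' : ∀ {m n : ℕ} (hmn : m ≤ n), AdicCompletion.transitionMap I A hmn ∘ₗ g n = g m := by
    intro m n hmn
    induction n, hmn using Nat.le_induction with
    | base => ext b; simp
    | succ n hmn ih =>
      rw [← ih, ← hcomp n]
      ext b
      simp
  have hker : ∀ n, (I ^ n • ⊤ : Submodule R B) ≤ LinearMap.ker (g n) := fun n =>
    Submodule.smul_le.2 fun c hc b _ => by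
      rw [LinearMap.mem_ker, map_smul, smul_quotient_smul_top_eq_zero _ hc]
  refine ⟨AdicCompletion.lift I
    (fun n => Submodule.liftQ _ (g n) (hker n) ∘ₗ AdicCompletion.eval I B n) ?_, ?_⟩
  · intro m n hmn
    rw [← AdicCompletion.transitionMap_comp_eval I B hmn, ← LinearMap.comp_assoc,
      ← LinearMap.comp_assoc]
    congr 1
    refine Submodule.linearMap_qext _ ?_
    rw [LinearMap.comp_assoc, Submodule.liftQ_mkQ, hcomp' hmn]
    ext b
    simp
  · refine LinearMap.ext fun x => AdicCompletion.ext fun n => ?_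
    obtain ⟨a, ha⟩ := Submodule.mkQ_surjective _ (x.val n)
    have := LinearMap.congr_fun (hg n) a
    simpa [← ha] using this

/-- If `B` is separated and `A ⊆ B` satisfies `A ∩ 𝔪^n B = 𝔪^n A` and
`B/(A + 𝔪^n B)` is a free `R/𝔪^n`-module for all `n ≥ 1`, then `A^ → B^` splits.
(Freeness over `R/𝔪^n` is expressed as an `R`-linear isomorphism with a direct sum of
copies of `R/𝔪^n`.) -/
theorem completion_map_split (R : Type u) [CommRing R] [IsNoetherianRing R] [IsLocalRing R]
    (B : Type u) [AddCommGroup B] [Module R B]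
    (hB : IsHausdorff (maximalIdeal R) B) (A : Submodule R B)
    (hpure : ∀ n : ℕ, 1 ≤ n →
      A ⊓ (maximalIdeal R ^ n • ⊤ : Submodule R B) = maximalIdeal R ^ n • A)
    (hfree : ∀ n : ℕ, 1 ≤ n → ∃ κ : Type u, Nonempty
      ((B ⧸ (A ⊔ (maximalIdeal R ^ n • ⊤ : Submodule R B))) ≃ₗ[R]
        (κ →₀ R ⧸ (maximalIdeal R ^ n)))) :
    ∃ g : AdicCompletion (maximalIdeal R) B →ₗ[R] AdicCompletion (maximalIdeal R) A,
      g ∘ₗ ((AdicCompletion.map (maximalIdeal R) A.subtype).restrictScalars R) =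
        LinearMap.id := by
  set I := maximalIdeal R
  let T (n : ℕ) := {g : B →ₗ[R] A ⧸ (I ^ n • ⊤ : Submodule R A) //
    g ∘ₗ A.subtype = (I ^ n • ⊤ : Submodule R A).mkQ}
  have step (n : ℕ) (g : T n) : ∃ g' : T (n + 1),
      AdicCompletion.transitionMap I A n.le_succ ∘ₗ g'.1 = g.1 := by
    obtain ⟨κ, ⟨e⟩⟩ := hfree (n + 1) n.succ_pos
    obtain ⟨g', h1, h2⟩ := exists_mkQ_extension_lift A (I ^ (n + 1))
      (Submodule.pow_smul_top_le I A n.le_succ) (hpure (n + 1) n.succ_pos) e g.1 g.2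
    exact ⟨⟨g', h1⟩, h2⟩
  choose next hnext using step
  have : Subsingleton (A ⧸ (I ^ 0 • ⊤ : Submodule R A)) := by
    rw [Submodule.Quotient.subsingleton_iff]
    simp
  let g (n : ℕ) : T n := Nat.rec ⟨0, LinearMap.ext fun _ => Subsingleton.elim _ _⟩ next n
  exact AdicCompletion.exists_leftInverse_map_subtype I A (fun n => (g n).1) (fun n => (g n).2)
    fun n => hnext n (g n)
end

section
/- Let $(M_i)_{i\in I}$ be a family of totally separated flat $R$-modules, $M = \bigoplus_{i\in I} M_i$, $P = \prod_{i\in I} M_i$, and let $X$ be a finitely generated $R$-module. Then the induced map $\widehat{X \otimes_R M} \to \widehat{X \otimes_R P}$ of $\mathfrak m$-adic completions is a split monomorphism. -/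
/- Throughout, `(R, 𝔪)` is a commutative noetherian local ring and all modules are `R`-modules.
`AdicCompletion (maximalIdeal R) M` is the `𝔪`-adic completion `lim M/𝔪^n M` and
`IsHausdorff (maximalIdeal R) M` says that `M` is (`𝔪`-adically) separated. -/

open TensorProduct IsLocalRing

universe u

/-- Over a noetherian ring, a product of flat modules is flat. -/
theorem Module.Flat.pi_of_isNoetherianRing {R : Type*} [CommRing R] [IsNoetherianRing R]
    {ι : Type*} (M : ι → Type*) [∀ i, AddCommGroup (M i)] [∀ i, Module R (M i)]
    [∀ i, Module.Flat R (M i)] : Module.Flat R (∀ i, M i) := by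
  refine Module.Flat.of_forall_isTrivialRelation fun {l f x} hx => ?_
  obtain ⟨k, s, hs⟩ := Submodule.fg_iff_exists_fin_generating_family.mp
    (IsNoetherian.noetherian (LinearMap.ker (Fintype.linearCombination R f)))
  have hs0 (j : Fin k) : ∑ t, f t * s j t = 0 := by
    have : s j ∈ LinearMap.ker (Fintype.linearCombination R f) :=
      hs ▸ Submodule.subset_span ⟨j, rfl⟩
    simpa [Fintype.linearCombination_apply, mul_comm] using this
  have key (i : ι) : ∃ y : Fin k → M i, ∀ t, x t i = ∑ j, s j t • y j := by
    have hxi : ∑ t, f t • x t i = 0 := by simpa using congrFun hx i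
    obtain ⟨k', a, y, hxy, ha⟩ := Module.Flat.isTrivialRelation_of_sum_smul_eq_zero hxi
    have hmem (p : Fin k') : ∃ c : Fin k → R, ∑ j, c j • s j = fun t => a t p := by
      rw [← Submodule.mem_span_range_iff_exists_fun, hs]
      simpa [Fintype.linearCombination_apply, mul_comm] using ha p
    choose c hc using hmem
    refine ⟨fun j => ∑ p, c p j • y p, fun t => ?_⟩
    simp_rw [Finset.smul_sum]
    rw [Finset.sum_comm]
    refine (hxy t).trans ?_
    refine Finset.sum_congr rfl fun p _ => ?_
    rw [← congrFun (hc p) t]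
    simp [Finset.sum_smul, smul_smul, mul_comm]
  choose y hy using key
  refine ⟨k, fun t j => s j t, fun j i => y i j, fun t => ?_, hs0⟩
  ext i
  simpa using hy i t

/-- A map that becomes bijective modulo `I` stays bijective after tensoring with a module
annihilated by `I`. -/
theorem LinearMap.lTensor_bijective_of_isTorsionBySet {R : Type*} [CommRing R] (I : Ideal R)
    {A B : Type*} [AddCommGroup A] [Module R A] [AddCommGroup B] [Module R B]
    (f : A →ₗ[R] B) (hf : Function.Bijective (f.lTensor (R ⧸ I)))
    (Y : Type*) [AddCommGroup Y] [Module R Y] (hY : Module.IsTorsionBySet R Y I) :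
    Function.Bijective (f.lTensor Y) := by
  let := hY.module
  have : IsScalarTower R (R ⧸ I) Y := hY.isScalarTower
  let e : (R ⧸ I) ⊗[R] A ≃ₗ[R ⧸ I] (R ⧸ I) ⊗[R] B :=
    LinearEquiv.ofBijective (f.baseChange (R ⧸ I)) hf
  have h := AlgebraTensorModule.lTensor_comp_cancelBaseChange R (R ⧸ I) (R ⧸ I) (M := Y) f
  have hb : Function.Bijective (AlgebraTensorModule.lTensor (R ⧸ I) Y
      (AlgebraTensorModule.lTensor (R ⧸ I) (R ⧸ I) f)) :=
    (e.lTensor Y).bijective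
  have h' : f.lTensor Y ∘ AlgebraTensorModule.cancelBaseChange R (R ⧸ I) (R ⧸ I) Y A =
      AlgebraTensorModule.cancelBaseChange R (R ⧸ I) (R ⧸ I) Y B ∘ _ :=
    funext fun x => LinearMap.congr_fun h x
  refine (Function.Bijective.of_comp_iff _
    (AlgebraTensorModule.cancelBaseChange R (R ⧸ I) (R ⧸ I) Y A).bijective).mp ?_
  rw [h']
  exact (LinearEquiv.bijective _).comp hb

/-- A map between flat modules that becomes bijective modulo `I` stays bijective after tensoring
with a module annihilated by a power of `I`. -/
theorem LinearMap.lTensor_bijective_of_isTorsionBySet_pow {R : Type u} [CommRing R] (I : Ideal R)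
    {A B : Type*} [AddCommGroup A] [Module R A] [AddCommGroup B] [Module R B]
    [Module.Flat R A] [Module.Flat R B]
    (f : A →ₗ[R] B) (hf : Function.Bijective (f.lTensor (R ⧸ I))) (n : ℕ)
    (Y : Type*) [AddCommGroup Y] [Module R Y] (hY : Module.IsTorsionBySet R Y ↑(I ^ n)) :
    Function.Bijective (f.lTensor Y) := by
  induction n generalizing Y with
  | zero =>
    refine lTensor_bijective_of_isTorsionBySet I f hf Y fun y a => ?_
    have : y = 0 := by simpa using @hY y ⟨1, by simp⟩
    simp [this]
  | succ n ih =>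
    let Y' : Submodule R Y := I • ⊤
    have h₁ : Function.Bijective (f.lTensor Y') := by
      refine ih Y' fun y a => Subtype.ext ?_
      obtain ⟨y, hy⟩ := y
      obtain ⟨a, ha⟩ := a
      change a • y = 0
      refine Submodule.smul_induction_on hy (fun r hr z _ => ?_) fun z w hz hw => ?_
      · rw [smul_smul]
        exact @hY z ⟨a * r, pow_succ I n ▸ Ideal.mul_mem_mul ha hr⟩
      · rw [smul_add, hz, hw, add_zero]
    have h₂ : Function.Bijective (f.lTensor (Y ⧸ Y')) :=
      lTensor_bijective_of_isTorsionBySet I f hf _ (Module.isTorsionBySet_quotient_ideal_smul Y I)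
    have hex : Function.Exact Y'.subtype Y'.mkQ := exact_subtype_mkQ Y'
    have comm {U V : Type _} [AddCommGroup U] [Module R U] [AddCommGroup V] [Module R V]
        (g : U →ₗ[R] V) : g.rTensor B ∘ₗ f.lTensor U = f.lTensor V ∘ₗ g.rTensor A := by
      rw [rTensor_comp_lTensor, lTensor_comp_rTensor]
    have hA := rTensor_exact A hex Y'.mkQ_surjective
    have hB := rTensor_exact B hex Y'.mkQ_surjective
    refine bijective_of_surjective_of_bijective_of_bijective_of_injective
      (0 : Unit →ₗ[R] Y' ⊗[R] A) (Y'.subtype.rTensor A) (Y'.mkQ.rTensor A)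
      (0 : (Y ⧸ Y') ⊗[R] A →ₗ[R] Unit)
      (0 : Unit →ₗ[R] Y' ⊗[R] B) (Y'.subtype.rTensor B) (Y'.mkQ.rTensor B)
      (0 : (Y ⧸ Y') ⊗[R] B →ₗ[R] Unit) LinearMap.id _ _ _ LinearMap.id
      (by simp) (comm _) (comm _) (by simp) ?_ hA ?_ ?_ hB ?_ Function.surjective_id h₁ h₂
      Function.injective_id
    · exact (exact_zero_iff_injective _ _).mpr
        (Module.Flat.rTensor_preserves_injective_linearMap _ Y'.injective_subtype)
    · exact (exact_zero_iff_surjective _ _).mpr (rTensor_surjective A Y'.mkQ_surjective)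
    · exact (exact_zero_iff_injective _ _).mpr
        (Module.Flat.rTensor_preserves_injective_linearMap _ Y'.injective_subtype)
    · exact (exact_zero_iff_surjective _ _).mpr (rTensor_surjective B Y'.mkQ_surjective)

/-- A map that is bijective modulo all powers of `I` is bijective on `I`-adic completions. -/
theorem AdicCompletion.map_bijective_of_reduceModIdeal {R : Type*} [CommRing R] (I : Ideal R)
    {A B : Type*} [AddCommGroup A] [Module R A] [AddCommGroup B] [Module R B] (f : A →ₗ[R] B)
    (hf : ∀ n, Function.Bijective (f.reduceModIdeal (I ^ n))) :
    Function.Bijective (AdicCompletion.map I f) := by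
  refine ⟨fun x y hxy => ?_, fun y => ?_⟩
  · ext n
    refine (hf n).1 ?_
    rw [← map_val_apply, ← map_val_apply, hxy]
  · choose x hx using fun n => (hf n).2 (y.val n)
    refine ⟨⟨x, fun {m n} hmn => (hf m).1 ?_⟩, AdicCompletion.ext fun n => hx n⟩
    rw [hx, ← y.2 hmn, ← hx n]
    exact (LinearMap.congr_fun (transitionMap_comp_reduceModIdeal I f hmn) (x n)).symm

theorem AdicCompletion.map_lTensor_bijective {R : Type u} [CommRing R] (I : Ideal R)
    {A B : Type*} [AddCommGroup A] [Module R A] [AddCommGroup B] [Module R B]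
    [Module.Flat R A] [Module.Flat R B]
    (f : A →ₗ[R] B) (hf : Function.Bijective (f.lTensor (R ⧸ I)))
    (X : Type*) [AddCommGroup X] [Module R X] :
    Function.Bijective (AdicCompletion.map I (f.lTensor X)) := by
  refine map_bijective_of_reduceModIdeal I _ fun n => ?_
  have hT : Module.IsTorsionBySet R ((R ⧸ I ^ n) ⊗[R] X) ↑(I ^ n) := by
    intro y ⟨a, ha⟩
    change a • y = 0
    induction y with
    | zero => simp
    | add y z hy hz => rw [smul_add, hy, hz, add_zero]
    | tmul r x =>
      have : a • r = 0 := by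
        rw [Algebra.smul_def, Ideal.Quotient.algebraMap_eq,
          Ideal.Quotient.eq_zero_iff_mem.mpr ha, zero_mul]
      rw [smul_tmul', this, zero_tmul]
  let eA := (TensorProduct.assoc R (R ⧸ I ^ n) X A) ≪≫ₗ
    quotTensorEquivQuotSMul (X ⊗[R] A) (I ^ n)
  let eB := (TensorProduct.assoc R (R ⧸ I ^ n) X B) ≪≫ₗ
    quotTensorEquivQuotSMul (X ⊗[R] B) (I ^ n)
  have hcomm : ((f.lTensor X).reduceModIdeal (I ^ n)).restrictScalars R ∘ₗ eA.toLinearMap =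
      eB.toLinearMap ∘ₗ f.lTensor ((R ⧸ I ^ n) ⊗[R] X) := by
    refine TensorProduct.ext_threefold fun r x a => ?_
    obtain ⟨r, rfl⟩ := Ideal.Quotient.mk_surjective r
    simp [eA, eB, quotTensorEquivQuotSMul_mk_tmul, -Submodule.Quotient.mk_smul]
  have hb : Function.Bijective
      (⇑((f.lTensor X).reduceModIdeal (I ^ n)) ∘ eA) := by
    have : (⇑((f.lTensor X).reduceModIdeal (I ^ n)) ∘ eA) =
        eB ∘ (f.lTensor ((R ⧸ I ^ n) ⊗[R] X)) := funext fun x => LinearMap.congr_fun hcomm x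
    rw [this]
    exact eB.bijective.comp (f.lTensor_bijective_of_isTorsionBySet_pow I hf n _ hT)
  exact (Function.Bijective.of_comp_iff _ eA.bijective).mp hb


/-- If `1 ⊗ e i` form a basis of `S ⊗ N`, then the map `R^(κ) → N` given by `e` becomes bijective
over `S`. -/
theorem LinearMap.lTensor_linearCombination_bijective {R S N κ : Type*} [CommRing R] [CommRing S]
    [Algebra R S] [AddCommGroup N] [Module R N] (b : Module.Basis κ S (S ⊗[R] N)) (e : κ → N)
    (hb : ∀ i, b i = 1 ⊗ₜ e i) :
    Function.Bijective ((Finsupp.linearCombination R e).lTensor S) := by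
  let b₀ := (Finsupp.basisSingleOne (R := R) (ι := κ)).baseChange S
  have h : (Finsupp.linearCombination R e).baseChange S = (b₀.equiv b (Equiv.refl κ)).toLinearMap :=
    b₀.ext fun i => by
      rw [LinearEquiv.coe_coe, Module.Basis.equiv_apply]
      simp [b₀, hb]
  have h' : ⇑((Finsupp.linearCombination R e).lTensor S) = b₀.equiv b (Equiv.refl κ) :=
    congrArg DFunLike.coe h
  rw [h']
  exact LinearEquiv.bijective _

theorem Module.Basis.sumExtend_inl {K V ι : Type*} [DivisionRing K] [AddCommGroup V] [Module K V]
    {v : ι → V} (hs : LinearIndependent K v) (i : ι) :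
    Module.Basis.sumExtend hs (Sum.inl i) = v i := by
  simp only [sumExtend, reindex_apply, extend_apply_self]
  rfl

/-- A map of flat modules that is injective modulo a maximal ideal `I` splits after tensoring with
any module and `I`-adic completion. -/
theorem AdicCompletion.exists_comp_map_lTensor_eq_id {R : Type u} [CommRing R] (I : Ideal R)
    [I.IsMaximal] {A B : Type*} [AddCommGroup A] [Module R A] [AddCommGroup B] [Module R B]
    [Module.Flat R A] [Module.Flat R B]
    (f : A →ₗ[R] B) (hf : Function.Injective (f.lTensor (R ⧸ I)))
    (X : Type*) [AddCommGroup X] [Module R X] :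
    ∃ g : AdicCompletion I (X ⊗[R] B) →ₗ[AdicCompletion I R] AdicCompletion I (X ⊗[R] A),
      g ∘ₗ AdicCompletion.map I (f.lTensor X) = LinearMap.id := by
  let := Ideal.Quotient.field I
  obtain ⟨κ, ⟨bA⟩⟩ := Module.Basis.exists_basis (R ⧸ I) ((R ⧸ I) ⊗[R] A)
  choose eA heA using fun i => TensorProduct.mk_surjective R A (R ⧸ I)
    Ideal.Quotient.mk_surjective (bA i)
  have hli : LinearIndependent (R ⧸ I) (f.baseChange (R ⧸ I) ∘ bA) :=
    bA.linearIndependent.map' _ (LinearMap.ker_eq_bot.mpr hf)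
  let τ := Module.Basis.sumExtendIndex hli
  let bB : Module.Basis (κ ⊕ τ) (R ⧸ I) ((R ⧸ I) ⊗[R] B) := Module.Basis.sumExtend hli
  choose eC heC using fun i => TensorProduct.mk_surjective R B (R ⧸ I)
    Ideal.Quotient.mk_surjective (bB (Sum.inr i))
  let eB := Sum.elim (f ∘ eA) eC
  have heB (i) : bB i = 1 ⊗ₜ eB i := by
    rcases i with i | i
    · refine (Module.Basis.sumExtend_inl hli i).trans ?_
      simp [eB, ← heA]
    · exact (heC i).symm
  let pA := Finsupp.linearCombination R eA
  let pB := Finsupp.linearCombination R eB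
  have hA := map_lTensor_bijective I pA (LinearMap.lTensor_linearCombination_bijective bA eA
    fun i => (heA i).symm) X
  have hB := map_lTensor_bijective I pB (LinearMap.lTensor_linearCombination_bijective bB eB
    heB) X
  let s : (κ →₀ R) →ₗ[R] (κ ⊕ τ →₀ R) := Finsupp.lmapDomain R R Sum.inl
  let r : (κ ⊕ τ →₀ R) →ₗ[R] (κ →₀ R) :=
    Finsupp.linearCombination R (Sum.elim (fun i => Finsupp.single i 1) 0)
  have hrs : r ∘ₗ s = LinearMap.id := by
    ext i : 2
    simp [r, s]
  have hsq : f ∘ₗ pA = pB ∘ₗ s := by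
    ext i
    simp [pA, pB, s, eB]
  let β := LinearEquiv.ofBijective _ hB
  refine ⟨map I (pA.lTensor X) ∘ₗ map I (r.lTensor X) ∘ₗ β.symm.toLinearMap, ?_⟩
  refine LinearMap.ext fun x => ?_
  obtain ⟨x, rfl⟩ := hA.2 x
  have h₁ : map I (f.lTensor X) (map I (pA.lTensor X) x) = β (map I (s.lTensor X) x) := by
    rw [LinearEquiv.ofBijective_apply, map_comp_apply, map_comp_apply, ← LinearMap.lTensor_comp,
      ← LinearMap.lTensor_comp, hsq]
  simp only [LinearMap.comp_apply, h₁, LinearEquiv.coe_coe, LinearEquiv.symm_apply_apply]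
  rw [map_comp_apply I (s.lTensor X), ← LinearMap.lTensor_comp, hrs, LinearMap.lTensor_id, map_id]
  rfl

/-- The canonical map from a direct sum to the product stays injective after tensoring with a
cyclic module. -/
theorem LinearMap.lTensor_pi_lapply_injective {R : Type*} [CommRing R] (I : Ideal R)
    {ι : Type*} (M : ι → Type*) [∀ i, AddCommGroup (M i)] [∀ i, Module R (M i)] :
    Function.Injective ((LinearMap.pi (fun i => DFinsupp.lapply i) :
      (Π₀ i, M i) →ₗ[R] (i : ι) → M i).lTensor (R ⧸ I)) := by
  classical
  refine (injective_iff_map_eq_zero _).mpr fun z hz => ?_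
  obtain ⟨m, rfl⟩ := TensorProduct.mk_surjective R _ (R ⧸ I) Ideal.Quotient.mk_surjective z
  have h (i : ι) : (1 : R ⧸ I) ⊗ₜ[R] m i = 0 := by
    simpa using congrArg ((LinearMap.proj i).lTensor (R ⧸ I)) hz
  rw [← DFinsupp.sum_single (f := m), DFinsupp.sum, map_sum]
  refine Finset.sum_eq_zero fun i _ => ?_
  simpa using congrArg ((DFinsupp.lsingle i).lTensor (R ⧸ I)) (h i)

/-- If all `M i` are totally separated and flat and `X` is finitely
generated, then `(X ⊗ ⊕ M i)^ → (X ⊗ ∏ M i)^` is a split monomorphism. -/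
theorem completion_tensor_sum_prod_split (R : Type u) [CommRing R] [IsNoetherianRing R]
    [IsLocalRing R] {ι : Type u} (M : ι → Type u)
    [∀ i, AddCommGroup (M i)] [∀ i, Module R (M i)]
    (htot : ∀ i, IsTotallySeparatedModule R (M i)) (hflat : ∀ i, Module.Flat R (M i))
    (X : Type u) [AddCommGroup X] [Module R X] [Module.Finite R X] :
    ∃ g : AdicCompletion (maximalIdeal R) (X ⊗[R] ((i : ι) → M i)) →ₗ[R]
        AdicCompletion (maximalIdeal R) (X ⊗[R] (Π₀ i, M i)),
      g ∘ₗ ((AdicCompletion.map (maximalIdeal R)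
          (LinearMap.lTensor X
            (LinearMap.pi (fun i => DFinsupp.lapply i) :
              (Π₀ i, M i) →ₗ[R] (i : ι) → M i))).restrictScalars R) = LinearMap.id := by
  have := Module.Flat.pi_of_isNoetherianRing (R := R) M
  have := Module.Flat.dfinsupp_iff.mpr hflat
  obtain ⟨g, hg⟩ := AdicCompletion.exists_comp_map_lTensor_eq_id (maximalIdeal R) _
    (LinearMap.lTensor_pi_lapply_injective (maximalIdeal R) M) X
  exact ⟨g.restrictScalars R, LinearMap.ext fun x => LinearMap.congr_fun hg x⟩
end

section
/- Let $M = \bigoplus_{i\in I} M_i$ where every $M_i$ is a finitely generated $R$-module, and assume that for each $n \ge 1$ the quotient $M_i/\mathfrak m^n M_i$ is a free $R/\mathfrak m^n$-module for all but finitely many $i \in I$. Then the $\mathfrak m$-adic completion $\widehat M$ is pure-injective. -/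
/- Throughout, `(R, 𝔪)` is a commutative noetherian local ring and all modules are `R`-modules.
`AdicCompletion (maximalIdeal R) M` is the `𝔪`-adic completion `lim M/𝔪^n M` and
`IsHausdorff (maximalIdeal R) M` says that `M` is (`𝔪`-adically) separated. -/

open TensorProduct IsLocalRing

universe u

section EssentialExtension

variable {R : Type u} [CommRing R] [IsLocalRing R]

/-- `E` is an essential extension of the residue field `R ∙ s`, where `s ∈ E`. -/
structure IsEssentialOverResidueField (E : Type u) [AddCommGroup E] [Module R E] (s : E) :
    Prop where
  ne_zero : s ≠ 0
  smul_eq_zero : ∀ a ∈ maximalIdeal R, a • s = 0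
  exists_smul_eq : ∀ x : E, x ≠ 0 → ∃ a : R, a • x = s

namespace IsEssentialOverResidueField

variable {E : Type u} [AddCommGroup E] [Module R E] {s : E}

lemma exists_pow_smul_eq_zero [IsNoetherianRing R] (h : IsEssentialOverResidueField (R := R) E s)
    (x : E) : ∃ n, ∀ a ∈ maximalIdeal R ^ n, a • x = 0 := by
  by_contra! hx
  have hmem (n : ℕ) : s ∈ maximalIdeal R ^ n • (R ∙ x) := by
    obtain ⟨a, ha, hax⟩ := hx n
    obtain ⟨b, hb⟩ := h.exists_smul_eq _ hax
    rw [← hb]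
    exact Submodule.smul_mem _ _ (Submodule.smul_mem_smul ha (Submodule.mem_span_singleton_self x))
  have hx : s ∈ R ∙ x := by simpa using hmem 0
  have hbot := Ideal.iInf_pow_smul_eq_bot_of_isLocalRing (M := (R ∙ x : Submodule R E))
    (maximalIdeal R) (Ideal.IsPrime.ne_top inferInstance)
  have : (⟨s, hx⟩ : (R ∙ x : Submodule R E)) ∈
      (⨅ i : ℕ, maximalIdeal R ^ i • ⊤ : Submodule R (R ∙ x : Submodule R E)) := by
    rw [Submodule.mem_iInf]
    intro n
    rw [Submodule.mem_smul_top_iff]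
    exact hmem n
  rw [hbot, Submodule.mem_bot] at this
  exact h.ne_zero (congrArg Subtype.val this)

lemma mem_span_of_smul_eq_zero (h : IsEssentialOverResidueField (R := R) E s) (x : E)
    (hx : ∀ a ∈ maximalIdeal R, a • x = 0) : x ∈ R ∙ s := by
  by_cases hx0 : x = 0
  · simp [hx0]
  obtain ⟨a, ha⟩ := h.exists_smul_eq x hx0
  have hu : IsUnit a := by
    by_contra hu
    exact h.ne_zero (by rw [← ha, hx a ((mem_maximalIdeal a).2 hu)])
  obtain ⟨u, rfl⟩ := hu
  exact Submodule.mem_span_singleton.2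
    ⟨(u⁻¹ : Rˣ), by rw [← ha, smul_smul, Units.inv_mul, one_smul]⟩

lemma length_span_le (h : IsEssentialOverResidueField (R := R) E s) :
    Module.length R (R ∙ s : Submodule R E) ≤ 1 := by
  have : IsSimpleModule R (R ⧸ maximalIdeal R) :=
    isSimpleModule_iff_isCoatom.2 (Ideal.isMaximal_def.1 inferInstance)
  let f : (R ⧸ maximalIdeal R) →ₗ[R] (R ∙ s : Submodule R E) :=
    (maximalIdeal R).liftQ (LinearMap.toSpanSingleton R (R ∙ s : Submodule R E)
      ⟨s, Submodule.mem_span_singleton_self s⟩) fun a ha ↦ by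
        simpa [LinearMap.mem_ker] using h.smul_eq_zero a ha
  have hf : Function.Surjective f := by
    rintro ⟨y, hy⟩
    obtain ⟨a, rfl⟩ := Submodule.mem_span_singleton.1 hy
    exact ⟨Submodule.Quotient.mk a, rfl⟩
  exact (Module.length_le_of_surjective f hf).trans_eq (Module.length_eq_one R _)

lemma length_hom_le_one (h : IsEssentialOverResidueField (R := R) E s)
    (X : Type u) [AddCommGroup X] [Module R X] [IsSimpleModule R X] :
    Module.length R (X →ₗ[R] E) ≤ 1 := by
  obtain ⟨I, hI, ⟨e⟩⟩ := isSimpleModule_iff_quot_maximal.1 ‹IsSimpleModule R X›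
  obtain rfl := eq_maximalIdeal hI
  let x := e.symm (Submodule.Quotient.mk 1)
  have hx (a : R) : a • x = e.symm (Submodule.Quotient.mk a) := by
    rw [← map_smul, ← Submodule.Quotient.mk_smul, smul_eq_mul, mul_one]
  let f : (X →ₗ[R] E) →ₗ[R] (R ∙ s : Submodule R E) :=
    LinearMap.codRestrict _ (LinearMap.applyₗ x) fun φ ↦ h.mem_span_of_smul_eq_zero _ fun a ha ↦ by
      rw [LinearMap.applyₗ_apply_apply, ← map_smul, hx, (Submodule.Quotient.mk_eq_zero _).2 ha,
        map_zero, map_zero]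
  have hf : Function.Injective f := by
    intro φ ψ hφ
    ext y
    obtain ⟨a, ha⟩ := Submodule.Quotient.mk_surjective _ (e y)
    have hy : y = a • x := by rw [hx, ha, e.symm_apply_apply]
    rw [hy, map_smul, map_smul]
    exact congrArg (a • ·) (congrArg Subtype.val hφ)
  exact (Module.length_le_of_injective f hf).trans h.length_span_le

lemma length_hom_le (h : IsEssentialOverResidueField (R := R) E s)
    (X : Type u) [AddCommGroup X] [Module R X] (hX : IsFiniteLength R X) :
    Module.length R (X →ₗ[R] E) ≤ Module.length R X := by
  induction hX with
  | of_subsingleton => simp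
  | @of_simple_quotient X _ _ N _ _ ih =>
    let g := LinearMap.lcomp R E N.subtype
    have hf : Function.Injective (LinearMap.lcomp R E N.mkQ) :=
      LinearMap.lcomp_injective_of_surjective _ N.mkQ_surjective
    have H : Function.Exact (LinearMap.lcomp R E N.mkQ) g.rangeRestrict := by
      intro φ
      constructor
      · intro hφ
        refine ⟨N.liftQ φ fun x hx ↦ ?_, by ext; simp⟩
        exact LinearMap.congr_fun (congrArg Subtype.val hφ) ⟨x, hx⟩
      · rintro ⟨ψ, rfl⟩
        ext x
        simp [g, (Submodule.Quotient.mk_eq_zero N).2 x.2]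
    rw [Module.length_eq_add_of_exact _ _ hf g.surjective_rangeRestrict H,
      Module.length_eq_add_of_exact _ _ N.subtype_injective N.mkQ_surjective
        (LinearMap.exact_subtype_mkQ N), Module.length_eq_one R (X ⧸ N), add_comm]
    gcongr
    · exact (Module.length_le_of_injective _ (LinearMap.range g).subtype_injective).trans ih
    · exact h.length_hom_le_one _

lemma isFiniteLength_hom (h : IsEssentialOverResidueField (R := R) E s)
    (X : Type u) [AddCommGroup X] [Module R X] (hX : IsFiniteLength R X) :
    IsFiniteLength R (X →ₗ[R] E) := by
  rw [← Module.length_ne_top_iff] at hX ⊢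
  exact ne_top_of_le_ne_top hX (h.length_hom_le X (Module.length_ne_top_iff.1 hX))

lemma exists_apply_ne_zero [Module.Injective R E] (h : IsEssentialOverResidueField (R := R) E s)
    {X : Type u} [AddCommGroup X] [Module R X] {x : X} (hx : x ≠ 0) :
    ∃ ψ : X →ₗ[R] E, ψ x ≠ 0 := by
  let t := LinearMap.toSpanSingleton R X x
  have hker : LinearMap.ker t ≤ LinearMap.ker (LinearMap.toSpanSingleton R E s) := by
    intro a ha
    refine h.smul_eq_zero a ((mem_maximalIdeal a).2 fun hu ↦ hx ?_)
    exact hu.smul_eq_zero.1 ha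
  obtain ⟨ψ, hψ⟩ := Module.Injective.extension_property R E _ _
    ((LinearMap.ker t).liftQ t le_rfl)
    (LinearMap.ker_eq_bot.1 (Submodule.ker_liftQ_eq_bot _ _ _ le_rfl))
    ((LinearMap.ker t).liftQ _ hker)
  refine ⟨ψ, ?_⟩
  have := LinearMap.congr_fun hψ (Submodule.Quotient.mk 1)
  simp only [LinearMap.comp_apply, Submodule.liftQ_apply, t,
    LinearMap.toSpanSingleton_apply_one] at this
  rw [this]
  exact h.ne_zero

/-- Modules of finite length are reflexive with respect to the duality into an injective hull of
the residue field. -/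
lemma bijective_applyₗ [Module.Injective R E] (h : IsEssentialOverResidueField (R := R) E s)
    (X : Type u) [AddCommGroup X] [Module R X] (hX : IsFiniteLength R X) :
    Function.Bijective (LinearMap.applyₗ : X →ₗ[R] (X →ₗ[R] E) →ₗ[R] E) := by
  set ev : X →ₗ[R] (X →ₗ[R] E) →ₗ[R] E := LinearMap.applyₗ
  have hinj : Function.Injective ev := by
    refine (injective_iff_map_eq_zero ev).2 fun x hx ↦ ?_
    by_contra hx0
    obtain ⟨ψ, hψ⟩ := h.exists_apply_ne_zero hx0
    exact hψ (LinearMap.congr_fun hx ψ)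
  refine ⟨hinj, ?_⟩
  have hle := (h.length_hom_le _ (h.isFiniteLength_hom X hX)).trans (h.length_hom_le X hX)
  rw [Module.length_eq_add_of_exact ev (LinearMap.range ev).mkQ hinj (Submodule.mkQ_surjective _)
    (LinearMap.exact_map_mkQ_range ev)] at hle
  have h0 : Module.length R (((X →ₗ[R] E) →ₗ[R] E) ⧸ LinearMap.range ev) = 0 := by
    simpa using ENat.le_sub_of_add_le_left (Module.length_ne_top_iff.2 hX) hle
  rw [Module.length_eq_zero_iff, Submodule.Quotient.subsingleton_iff] at h0
  exact LinearMap.range_eq_top.1 h0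

end IsEssentialOverResidueField

lemma isFiniteLength_quotient_pow_maximalIdeal (R : Type u) [CommRing R] [IsLocalRing R]
    [IsNoetherianRing R] (n : ℕ) : IsFiniteLength R (R ⧸ maximalIdeal R ^ n) := by
  have : IsArtinianRing (R ⧸ maximalIdeal R ^ n) := by
    rcases subsingleton_or_nontrivial (R ⧸ maximalIdeal R ^ n) with _ | _
    · infer_instance
    have := IsLocalRing.of_surjective' (Ideal.Quotient.mk (maximalIdeal R ^ n))
      Ideal.Quotient.mk_surjective
    rw [isArtinianRing_iff_isNilpotent_maximalIdeal]
    have hle : maximalIdeal (R ⧸ maximalIdeal R ^ n) ≤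
        (maximalIdeal R).map (Ideal.Quotient.mk (maximalIdeal R ^ n)) := by
      intro x hx
      obtain ⟨a, rfl⟩ := Ideal.Quotient.mk_surjective x
      refine Ideal.mem_map_of_mem _ ((mem_maximalIdeal a).2 fun hu ↦ ?_)
      exact (mem_maximalIdeal _).1 hx (hu.map _)
    refine ⟨n, le_bot_iff.1 ((Ideal.pow_right_mono hle n).trans ?_)⟩
    rw [← Ideal.map_pow, Ideal.map_quotient_self]
  rw [isFiniteLength_iff_isNoetherian_isArtinian]
  exact ⟨inferInstance, isArtinian_of_surjective_algebraMap
    (R := R ⧸ maximalIdeal R ^ n) Ideal.Quotient.mk_surjective⟩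

/-- The residue field of a noetherian local ring has an injective essential extension. -/
lemma exists_isEssentialOverResidueField_injective (R : Type u) [CommRing R] [IsLocalRing R]
    [IsNoetherianRing R] : ∃ (E : Type u) (_ : AddCommGroup E) (_ : Module R E) (s : E),
      Module.Injective R E ∧ IsEssentialOverResidueField (R := R) E s := by
  obtain ⟨Q, _, _, hQ, j, hj⟩ : ∃ (Q : Type u) (_ : AddCommGroup Q) (_ : Module R Q)
      (_ : Module.Injective R Q) (j : (R ⧸ maximalIdeal R) →ₗ[R] Q), Function.Injective j := by
    let X : ModuleCat R := ModuleCat.of R (R ⧸ maximalIdeal R)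
    have hX : CategoryTheory.Injective
        (ModuleCat.of R (CategoryTheory.Injective.under (C := ModuleCat R) X)) :=
      inferInstanceAs
        (CategoryTheory.Injective (CategoryTheory.Injective.under (C := ModuleCat R) X))
    refine ⟨CategoryTheory.Injective.under (C := ModuleCat R) X, inferInstance, inferInstance,
      Module.injective_module_of_injective_object R _,
      (CategoryTheory.Injective.ι (C := ModuleCat R) X).hom, ?_⟩
    exact (ModuleCat.mono_iff_injective _).1 inferInstance
  let t : Q := j (Submodule.Quotient.mk 1)
  have ht0 : t ≠ 0 := by
    intro h0
    have := (map_eq_zero_iff j hj).1 h0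
    rw [Submodule.Quotient.mk_eq_zero] at this
    exact (Ideal.ne_top_iff_one _).1 (Ideal.IsPrime.ne_top inferInstance) this
  have htm (a : R) (ha : a ∈ maximalIdeal R) : a • t = 0 := by
    rw [← map_smul, ← Submodule.Quotient.mk_smul, smul_eq_mul, mul_one,
      (Submodule.Quotient.mk_eq_zero _).2 ha, map_zero]
  obtain ⟨C, -, hC⟩ := zorn_le_nonempty₀ {C : Submodule R Q | t ∉ C} (by
    intro c hc hchain y hy
    refine ⟨sSup c, fun hmem ↦ ?_, fun z hz ↦ le_sSup hz⟩
    obtain ⟨z, hz, htz⟩ := (Submodule.mem_sSup_of_directed ⟨y, hy⟩ hchain.directedOn).1 hmem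
    exact hc hz htz) ⊥ (by simpa using ht0)
  have hess : IsEssentialOverResidueField (R := R) (Q ⧸ C) (Submodule.Quotient.mk t) := by
    refine ⟨fun h0 ↦ hC.prop ((Submodule.Quotient.mk_eq_zero _).1 h0), fun a ha ↦ ?_, fun x hx ↦ ?_⟩
    · rw [← Submodule.Quotient.mk_smul, htm a ha, Submodule.Quotient.mk_zero]
    · obtain ⟨q, rfl⟩ := Submodule.Quotient.mk_surjective _ x
      have hmem : t ∈ C ⊔ R ∙ q := by
        by_contra hmem
        refine hx ((Submodule.Quotient.mk_eq_zero _).2 (hC.le_of_ge hmem le_sup_left ?_))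
        exact (le_sup_right : R ∙ q ≤ C ⊔ R ∙ q) (Submodule.mem_span_singleton_self q)
      obtain ⟨c, hc, y, hy, hcy⟩ := Submodule.mem_sup.1 hmem
      obtain ⟨a, rfl⟩ := Submodule.mem_span_singleton.1 hy
      refine ⟨a, ?_⟩
      rw [← hcy, Submodule.Quotient.mk_add, (Submodule.Quotient.mk_eq_zero _).2 hc, zero_add,
        Submodule.Quotient.mk_smul]
  have hmt : (C.mkQ ∘ₗ j) (Submodule.Quotient.mk 1) = Submodule.Quotient.mk t := rfl
  have hinj : Function.Injective (C.mkQ ∘ₗ j) := by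
    refine (injective_iff_map_eq_zero _).2 fun x hx ↦ ?_
    obtain ⟨a, rfl⟩ := Submodule.Quotient.mk_surjective _ x
    rw [Submodule.Quotient.mk_eq_zero, mem_maximalIdeal]
    intro hu
    have h1 : a • (Submodule.Quotient.mk t : Q ⧸ C) = 0 := by
      rw [← hmt, ← map_smul, ← Submodule.Quotient.mk_smul, smul_eq_mul, mul_one, hx]
    exact hess.ne_zero (hu.smul_eq_zero.1 h1)
  obtain ⟨f, hf⟩ := Module.Injective.extension_property R Q _ _ (C.mkQ ∘ₗ j) hinj j
  have hft : f (Submodule.Quotient.mk t) = t := LinearMap.congr_fun hf (Submodule.Quotient.mk 1)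
  let g : (Q ⧸ C) →ₗ[R] (Q ⧸ C) := C.mkQ ∘ₗ f
  have hg : Function.Injective g := by
    refine (injective_iff_map_eq_zero _).2 fun x hx ↦ ?_
    by_contra hx0
    obtain ⟨a, ha⟩ := hess.exists_smul_eq x hx0
    apply hess.ne_zero
    calc Submodule.Quotient.mk t = g (Submodule.Quotient.mk t) := by simp [g, hft]
      _ = 0 := by rw [← ha, map_smul, hx, smul_zero]
  have hg' : Function.Surjective g := by
    intro e
    obtain ⟨n, hn⟩ := hess.exists_pow_smul_eq_zero e
    replace hn : maximalIdeal R ^ n ≤ LinearMap.ker (LinearMap.toSpanSingleton R _ e) := hn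
    have := (isFiniteLength_iff_isNoetherian_isArtinian.1 (hess.isFiniteLength_hom _
      (isFiniteLength_quotient_pow_maximalIdeal R n))).2
    obtain ⟨u, hu⟩ := IsArtinian.surjective_of_injective_endomorphism
      (LinearMap.compRight R (M := R ⧸ maximalIdeal R ^ n) g)
      (fun u v huv ↦ LinearMap.ext fun x ↦ hg (LinearMap.congr_fun huv x))
      ((maximalIdeal R ^ n).liftQ (LinearMap.toSpanSingleton R _ e) hn)
    refine ⟨u (Submodule.Quotient.mk 1),
      (LinearMap.congr_fun hu (Submodule.Quotient.mk 1)).trans ?_⟩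
    rw [Submodule.liftQ_apply, LinearMap.toSpanSingleton_apply_one]
  let e := LinearEquiv.ofBijective g ⟨hg, hg'⟩
  refine ⟨Q ⧸ C, inferInstance, inferInstance, _, ⟨fun X Y _ _ _ _ i hi φ ↦ ?_⟩, hess⟩
  obtain ⟨h, hh⟩ := Module.Injective.extension_property R Q _ _ i hi (f ∘ₗ φ)
  refine ⟨e.symm.toLinearMap ∘ₗ C.mkQ ∘ₗ h, fun x ↦ e.injective ?_⟩
  have := LinearMap.congr_fun hh x
  simp only [LinearMap.comp_apply] at this
  simp only [LinearMap.comp_apply, LinearEquiv.coe_coe, e.apply_symm_apply, this]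
  rfl

end EssentialExtension

section Injective

variable {R : Type u} [CommRing R]

/-- Over a noetherian ring, the direct sum of copies of an injective module is a direct summand
of their product. -/
lemma exists_finsupp_retraction [IsNoetherianRing R] (E : Type u) [AddCommGroup E] [Module R E]
    [Module.Injective R E] (J : Type u) :
    ∃ σ : (J → E) →ₗ[R] (J →₀ E), ∀ c : J →₀ E, σ c = c := by
  have hinj : Module.Injective R (J →₀ E) := by
    rw [← Module.Baer.iff_injective]
    intro I g
    obtain ⟨s, hs⟩ := (Module.Finite.fg_top : (⊤ : Submodule R I).FG)
    classical
    let S : Finset J := s.biUnion fun a ↦ (g a).support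
    have hg (a : I) : g a ∈ Finsupp.supported E R (S : Set J) := by
      have : (⊤ : Submodule R I) ≤ (Finsupp.supported E R (S : Set J)).comap g := by
        rw [← hs, Submodule.span_le]
        intro a ha
        rw [SetLike.mem_coe, Submodule.mem_comap, Finsupp.mem_supported]
        exact_mod_cast Finset.subset_biUnion_of_mem (fun a ↦ (g a).support) ha
      exact this trivial
    obtain ⟨g', hg'⟩ := Module.Injective.extension_property R (J → E) _ _ I.subtype
      I.subtype_injective (Finsupp.lcoeFun (R := R) ∘ₗ g)
    let τ : R →ₗ[R] (J →₀ E) := ∑ j ∈ S, Finsupp.lsingle j ∘ₗ LinearMap.proj j ∘ₗ g'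
    refine ⟨τ, fun a ha ↦ ?_⟩
    have h1 : g' a = g ⟨a, ha⟩ := LinearMap.congr_fun hg' ⟨a, ha⟩
    have h2 := (Finsupp.mem_supported R _).1 (hg ⟨a, ha⟩)
    ext j
    by_cases hj : j ∈ S
    · simp [τ, h1, Finsupp.finsetSum_apply, Finsupp.single_apply, hj]
    · have : g ⟨a, ha⟩ j = 0 := by
        by_contra h0
        exact hj (by exact_mod_cast h2 (Finsupp.mem_support_iff.2 h0))
      simp [τ, Finsupp.finsetSum_apply, Finsupp.single_apply, hj, this]
  obtain ⟨σ, hσ⟩ := Module.Injective.extension_property R (J →₀ E) _ _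
    (Finsupp.lcoeFun (R := R) : (J →₀ E) →ₗ[R] (J → E)) DFunLike.coe_injective LinearMap.id
  exact ⟨σ, fun c ↦ LinearMap.congr_fun hσ c⟩

lemma IsPureMono.exists_extension_hom {N Y : Type u} [AddCommGroup N] [Module R N]
    [AddCommGroup Y] [Module R Y] {f : N →ₗ[R] Y} (hf : IsPureMono R f)
    (A E : Type u) [AddCommGroup A] [Module R A] [AddCommGroup E] [Module R E]
    [Module.Injective R E] (φ : N →ₗ[R] A →ₗ[R] E) :
    ∃ g : Y →ₗ[R] A →ₗ[R] E, g ∘ₗ f = φ := by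
  obtain ⟨g, hg⟩ := Module.Injective.extension_property R E _ _ (LinearMap.lTensor A f) (hf.2 A)
    (TensorProduct.lift φ.flip)
  refine ⟨(TensorProduct.curry g).flip, ?_⟩
  ext n a
  simpa using LinearMap.congr_fun hg (a ⊗ₜ n)

/-- If `T : H → W` is surjective and `τ : H → H` maps into the preimage of the range of an
injective map `α : N → W` and preserves the value of `T` on that preimage, then `α` splits. -/
lemma exists_leftInverse_of_surjective {N W H : Type*} [AddCommGroup N] [Module R N]
    [AddCommGroup W] [Module R W] [AddCommGroup H] [Module R H] (α : N →ₗ[R] W)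
    (hα : Function.Injective α) (T : H →ₗ[R] W) (hT : Function.Surjective T) (τ : H →ₗ[R] H)
    (hτ : ∀ h, ∃ x, α x = T (τ h)) (hfix : ∀ h x, T h = α x → T (τ h) = T h) :
    ∃ β : W →ₗ[R] N, β ∘ₗ α = LinearMap.id := by
  let B : H →ₗ[R] N := (LinearEquiv.ofInjective α hα).symm.toLinearMap ∘ₗ
    (T ∘ₗ τ).codRestrict (LinearMap.range α) hτ
  have hB (h : H) (x : N) (hx : T h = α x) : B h = x := by
    simp only [B, LinearMap.comp_apply, LinearEquiv.coe_coe, LinearEquiv.symm_apply_eq]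
    exact Subtype.ext ((hfix h x hx).trans hx)
  refine ⟨(LinearMap.ker T).liftQ B (fun h hh ↦ hB h 0 (by simpa using hh)) ∘ₗ
    (T.quotKerEquivOfSurjective hT).symm.toLinearMap, ?_⟩
  ext x
  obtain ⟨h, hh⟩ := hT (α x)
  have : (T.quotKerEquivOfSurjective hT).symm (α x) = Submodule.Quotient.mk h := by
    rw [LinearEquiv.symm_apply_eq, ← hh]
    rfl
  simp only [LinearMap.comp_apply, LinearEquiv.coe_coe, this, LinearMap.id_apply]
  exact hB h x hh

end Injective

/-- A finitely generated module `M` over a local ring has a generating family which is a basis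
modulo `𝔪 ^ n` whenever `M/𝔪^n M` is free over `R/𝔪^n`. -/
lemma exists_span_and_coordinates (R : Type u) [CommRing R] [IsNoetherianRing R] [IsLocalRing R]
    (M : Type u) [AddCommGroup M] [Module R M] [Module.Finite R M] :
    ∃ (r : ℕ) (x : Fin r → M), Submodule.span R (Set.range x) = ⊤ ∧
      ∀ n : ℕ, 1 ≤ n → (∃ κ : Type u, Nonempty
        ((M ⧸ (maximalIdeal R ^ n • ⊤ : Submodule R M)) ≃ₗ[R]
          (κ →₀ R ⧸ (maximalIdeal R ^ n)))) →
        ∀ j, ∃ π : M →ₗ[R] R ⧸ maximalIdeal R ^ n, ∀ j', π (x j') = if j = j' then 1 else 0 := by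
  classical
  have hex : ∃ r : ℕ, ∃ x : Fin r → M, Submodule.span R (Set.range x) = ⊤ :=
    Module.Finite.exists_fin
  obtain ⟨x, hx⟩ := Nat.find_spec hex
  refine ⟨Nat.find hex, x, hx, fun n hn ↦ ?_⟩
  have hmin := fun k ↦ Nat.find_min' hex (m := k)
  generalize Nat.find hex = r at x hx hmin
  rintro ⟨κ, ⟨e⟩⟩ j
  set A := R ⧸ maximalIdeal R ^ n with hA
  have hpow : maximalIdeal R ^ n ≤ maximalIdeal R := Ideal.pow_le_self (by omega)
  have : Nontrivial A := Ideal.Quotient.nontrivial_iff.2 fun h ↦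
    Ideal.IsPrime.ne_top (inferInstanceAs (maximalIdeal R).IsPrime) (top_le_iff.1 (h ▸ hpow))
  have : Module.Finite R (κ →₀ A) := Module.Finite.equiv e
  have : Module.Finite A (κ →₀ A) := Module.Finite.of_restrictScalars_finite R A _
  have hκ : Finite κ := Module.Finite.finite_basis (Finsupp.basisSingleOne (R := A) (ι := κ))
  have hcard : r ≤ Nat.card κ := by
    choose y hy using fun k ↦ Submodule.Quotient.mk_surjective
      (maximalIdeal R ^ n • ⊤ : Submodule R M) (e.symm (Finsupp.single k 1))
    refine hmin _ ⟨y ∘ (Finite.equivFin κ).symm, ?_⟩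
    rw [Set.range_comp, Equiv.range_eq_univ, Set.image_univ, ← top_le_iff]
    refine Submodule.le_of_le_smul_of_le_jacobson_bot (I := maximalIdeal R ^ n) Module.Finite.fg_top
      (hpow.trans (maximalIdeal_le_jacobson _)) fun m _ ↦ ?_
    have hm : e (Submodule.Quotient.mk m) ∈
        (Submodule.span R (Set.range y)).map (e.toLinearMap ∘ₗ Submodule.mkQ _) := by
      rw [← Finsupp.sum_single (e (Submodule.Quotient.mk m))]
      refine Submodule.sum_mem _ fun k _ ↦ ?_
      obtain ⟨a, ha⟩ := Ideal.Quotient.mk_surjective (e (Submodule.Quotient.mk m) k)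
      refine ⟨a • y k, Submodule.smul_mem _ _ (Submodule.subset_span ⟨k, rfl⟩), ?_⟩
      rw [map_smul, LinearMap.comp_apply, Submodule.mkQ_apply, hy, LinearEquiv.coe_coe,
        e.apply_symm_apply, Finsupp.smul_single, ← ha]
      congr 1
      rw [Algebra.smul_def, mul_one]
      rfl
    obtain ⟨z, hz, hzm⟩ := hm
    have hzm' : (Submodule.Quotient.mk z : M ⧸ (maximalIdeal R ^ n • ⊤ : Submodule R M)) =
      Submodule.Quotient.mk m := e.injective hzm
    rw [← sub_add_cancel m z, add_comm]
    exact Submodule.add_mem_sup hz ((Submodule.Quotient.eq _).1 hzm'.symm)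
  let i : Fin r ↪ κ := (Fin.castLEEmb hcard).trans (Finite.equivFin κ).symm.toEmbedding
  let q : M →ₗ[R] (Fin r → A) := LinearMap.pi fun l ↦
    Finsupp.lapply (i l) ∘ₗ e.toLinearMap ∘ₗ Submodule.mkQ _
  have hq : Function.Surjective q := by
    intro w
    obtain ⟨m, hm⟩ := Submodule.Quotient.mk_surjective _
      (e.symm (Finsupp.embDomain i (Finsupp.equivFunOnFinite.symm w)))
    refine ⟨m, ?_⟩
    ext l
    simp [q, hm]
  let f : (Fin r → A) →ₗ[A] (Fin r → A) := Fintype.linearCombination A (q ∘ x)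
  have hf : Function.Surjective f := by
    intro w
    obtain ⟨m, rfl⟩ := hq w
    obtain ⟨a, rfl⟩ := (Submodule.mem_span_range_iff_exists_fun R).1
      (show m ∈ Submodule.span R (Set.range x) by rw [hx]; trivial)
    refine ⟨fun l ↦ algebraMap R A (a l), ?_⟩
    simp [f, Fintype.linearCombination_apply, map_sum]
  have hbij : Function.Bijective f := IsNoetherian.bijective_of_surjective_endomorphism f hf
  let F := LinearEquiv.ofBijective f hbij
  refine ⟨LinearMap.proj j ∘ₗ (F.symm.toLinearMap.restrictScalars R) ∘ₗ q, fun j' ↦ ?_⟩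
  have : F.symm (q (x j')) = Pi.single j' 1 := by
    rw [LinearEquiv.symm_apply_eq]
    simp [F, f]
  simp [this, Pi.single_apply]

lemma LinearMap.exists_pow_smul_top_le_ker {R : Type u} [CommRing R] (I : Ideal R)
    {M E : Type u} [AddCommGroup M] [Module R M] [Module.Finite R M] [AddCommGroup E] [Module R E]
    (hE : ∀ e : E, ∃ n, ∀ a ∈ I ^ n, a • e = 0) (ψ : M →ₗ[R] E) :
    ∃ n, (I ^ n • ⊤ : Submodule R M) ≤ LinearMap.ker ψ := by
  obtain ⟨S, hS⟩ := (Module.Finite.fg_top : (⊤ : Submodule R M).FG)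
  choose k hk using hE
  refine ⟨S.sup fun y ↦ k (ψ y), ?_⟩
  rw [← hS, Submodule.smul_le]
  intro a ha y hy
  have : Submodule.span R (S : Set M) ≤ LinearMap.ker (a • ψ) := by
    rw [Submodule.span_le]
    intro z hz
    exact hk _ a (Ideal.pow_le_pow_right (Finset.le_sup (f := fun y ↦ k (ψ y)) hz) ha)
  rw [LinearMap.mem_ker, map_smul]
  exact this hy

namespace AdicCompletion

variable {R : Type u} [CommRing R] {I : Ideal R} {M : Type u} [AddCommGroup M] [Module R M]

lemma eval_eq_mkQ_of_le {m n : ℕ} (hmn : m ≤ n) {x : AdicCompletion I M} {y : M}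
    (hy : eval I M n x = Submodule.mkQ _ y) : eval I M m x = Submodule.mkQ _ y := by
  rw [← transitionMap_comp_eval I M hmn, LinearMap.comp_apply, hy]
  rfl

/-- Homomorphisms which are continuous for the discrete topology on `E` extend to the completion;
this is the resulting pairing. -/
lemma exists_pairing {M' E : Type u} [AddCommGroup M'] [Module R M'] [AddCommGroup E] [Module R E]
    (hker : ∀ ψ : M' →ₗ[R] E, ∃ n, (I ^ n • ⊤ : Submodule R M') ≤ LinearMap.ker ψ)
    (p : M →ₗ[R] M') :
    ∃ α : AdicCompletion I M →ₗ[R] (M' →ₗ[R] E) →ₗ[R] E,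
      ∀ x ψ n y, (I ^ n • ⊤ : Submodule R M') ≤ LinearMap.ker ψ →
        eval I M n x = Submodule.mkQ _ y → α x ψ = ψ (p y) := by
  have hsub {ψ : M' →ₗ[R] E} {n : ℕ} (hn : (I ^ n • ⊤ : Submodule R M') ≤ LinearMap.ker ψ)
      {x : AdicCompletion I M} {y z : M} (hy : eval I M n x = Submodule.mkQ _ y)
      (hz : eval I M n x = Submodule.mkQ _ z) : ψ (p y) = ψ (p z) := by
    have h : y - z ∈ (I ^ n • ⊤ : Submodule R M) := (Submodule.Quotient.eq _).1 (hy.symm.trans hz)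
    have h' : p (y - z) ∈ (I ^ n • ⊤ : Submodule R M') :=
      ((Submodule.map_smul'' _ _ _).le.trans (Submodule.smul_mono le_rfl le_top))
        (Submodule.mem_map_of_mem h)
    simpa [sub_eq_zero] using hn h'
  have hex (x : AdicCompletion I M) (ψ : M' →ₗ[R] E) :
      ∃ v : E, ∀ n y, (I ^ n • ⊤ : Submodule R M') ≤ LinearMap.ker ψ →
        eval I M n x = Submodule.mkQ _ y → v = ψ (p y) := by
    obtain ⟨m, hm⟩ := hker ψ
    obtain ⟨z, hz⟩ := Submodule.mkQ_surjective _ (eval I M m x)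
    refine ⟨ψ (p z), fun n y hn hy ↦ ?_⟩
    rcases le_total m n with h | h
    · exact hsub hm hz.symm (eval_eq_mkQ_of_le h hy)
    · exact hsub hn (eval_eq_mkQ_of_le h hz.symm) hy
  choose v hv using hex
  refine ⟨LinearMap.mk₂ R v ?_ ?_ ?_ ?_, hv⟩
  · intro x x' ψ
    obtain ⟨n, hn⟩ := hker ψ
    obtain ⟨y, hy⟩ := Submodule.mkQ_surjective _ (eval I M n x)
    obtain ⟨y', hy'⟩ := Submodule.mkQ_surjective _ (eval I M n x')
    rw [hv x ψ n y hn hy.symm, hv x' ψ n y' hn hy'.symm, hv (x + x') ψ n (y + y') hn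
      (by rw [map_add, map_add, hy, hy']), map_add, map_add]
  · intro a x ψ
    obtain ⟨n, hn⟩ := hker ψ
    obtain ⟨y, hy⟩ := Submodule.mkQ_surjective _ (eval I M n x)
    rw [hv x ψ n y hn hy.symm, hv (a • x) ψ n (a • y) hn (by rw [map_smul, map_smul, hy]),
      map_smul, map_smul]
  · intro x ψ ψ'
    obtain ⟨n, hn⟩ := hker ψ
    obtain ⟨n', hn'⟩ := hker ψ'
    have h : (I ^ max n n' • ⊤ : Submodule R M') ≤ LinearMap.ker ψ :=
      (Submodule.smul_mono_left (Ideal.pow_le_pow_right (le_max_left _ _))).trans hn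
    have h' : (I ^ max n n' • ⊤ : Submodule R M') ≤ LinearMap.ker ψ' :=
      (Submodule.smul_mono_left (Ideal.pow_le_pow_right (le_max_right _ _))).trans hn'
    obtain ⟨y, hy⟩ := Submodule.mkQ_surjective _ (eval I M (max n n') x)
    rw [hv x ψ _ y h hy.symm, hv x ψ' _ y h' hy.symm, hv x (ψ + ψ') _ y ?_ hy.symm,
      LinearMap.add_apply]
    intro z hz
    simp [LinearMap.mem_ker.1 (h hz), LinearMap.mem_ker.1 (h' hz)]
  · intro a x ψ
    obtain ⟨n, hn⟩ := hker ψ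
    obtain ⟨y, hy⟩ := Submodule.mkQ_surjective _ (eval I M n x)
    rw [hv x ψ n y hn hy.symm, hv x (a • ψ) n y ?_ hy.symm, LinearMap.smul_apply]
    intro z hz
    simp [LinearMap.mem_ker.1 (hn hz)]

end AdicCompletion

namespace IsEssentialOverResidueField

variable {R : Type u} [CommRing R] [IsLocalRing R] {E : Type u} [AddCommGroup E]
  [Module R E] [Module.Injective R E] {s : E}

lemma mem_pow_maximalIdeal (h : IsEssentialOverResidueField (R := R) E s) {n : ℕ} {a : R}
    (ha : ∀ e : E, (∀ b ∈ maximalIdeal R ^ n, b • e = 0) → a • e = 0) :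
    a ∈ maximalIdeal R ^ n := by
  by_contra hmem
  obtain ⟨ψ, hψ⟩ := h.exists_apply_ne_zero
    (x := (Submodule.Quotient.mk a : R ⧸ maximalIdeal R ^ n))
    (by rwa [Ne, Submodule.Quotient.mk_eq_zero])
  apply hψ
  have h1 (b : R) : b • ψ (Submodule.Quotient.mk 1) = ψ (Submodule.Quotient.mk b) := by
    rw [← map_smul, ← Submodule.Quotient.mk_smul, smul_eq_mul, mul_one]
  rw [← h1]
  refine ha _ fun b hb ↦ ?_
  rw [h1, (Submodule.Quotient.mk_eq_zero _).2 hb, map_zero]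

/-- Homomorphisms from `E` to a direct sum of copies of `E` are given, on the part of `E` killed
by `𝔪 ^ n`, by finitely many scalars. -/
lemma exists_finsupp_smul_eq [IsNoetherianRing R] (h : IsEssentialOverResidueField (R := R) E s)
    {J : Type u} (g : E →ₗ[R] J →₀ E) (n : ℕ) :
    ∃ c : J →₀ R, ∀ e : E, (∀ a ∈ maximalIdeal R ^ n, a • e = 0) → ∀ j, g e j = c j • e := by
  classical
  let A := R ⧸ maximalIdeal R ^ n
  have hfin := h.isFiniteLength_hom A (isFiniteLength_quotient_pow_maximalIdeal R n)
  have := (isFiniteLength_iff_isNoetherian_isArtinian.1 hfin).1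
  obtain ⟨S, hS⟩ := (IsNoetherian.noetherian (⊤ : Submodule R (A →ₗ[R] E)))
  let one : A := Submodule.Quotient.mk 1
  let F : Finset J := S.biUnion fun ψ ↦ (g (ψ one)).support
  have hF (ψ : A →ₗ[R] E) : g (ψ one) ∈ Finsupp.supported E R (F : Set J) := by
    have : (⊤ : Submodule R (A →ₗ[R] E)) ≤
        (Finsupp.supported E R (F : Set J)).comap (g ∘ₗ LinearMap.applyₗ one) := by
      rw [← hS, Submodule.span_le]
      intro ψ hψ
      rw [SetLike.mem_coe, Submodule.mem_comap, Finsupp.mem_supported]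
      exact_mod_cast Finset.subset_biUnion_of_mem
        (fun ψ : A →ₗ[R] E ↦ (g (ψ one)).support) hψ
    exact this trivial
  have hc (j : J) : ∃ a : R, ∀ ψ : A →ₗ[R] E, g (ψ one) j = a • ψ one := by
    obtain ⟨x, hx⟩ := (h.bijective_applyₗ A (isFiniteLength_quotient_pow_maximalIdeal R n)).2
      (Finsupp.lapply j ∘ₗ g ∘ₗ LinearMap.applyₗ one)
    obtain ⟨a, rfl⟩ := Submodule.Quotient.mk_surjective _ x
    refine ⟨a, fun ψ ↦ (LinearMap.congr_fun hx ψ).symm.trans ?_⟩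
    rw [← map_smul, ← Submodule.Quotient.mk_smul, smul_eq_mul, mul_one]
    rfl
  choose c hc using hc
  refine ⟨Finsupp.onFinset F (fun j ↦ if j ∈ F then c j else 0) fun j hj ↦ by
    by_contra h0; exact hj (if_neg h0), fun e he j ↦ ?_⟩
  let ψ : A →ₗ[R] E := (maximalIdeal R ^ n).liftQ (LinearMap.toSpanSingleton R E e) he
  have hψ : ψ one = e :=
    (Submodule.liftQ_apply _ _ _).trans (LinearMap.toSpanSingleton_apply_one _ _ _)
  rw [Finsupp.onFinset_apply]
  split_ifs with hj
  · simpa [hψ] using hc j ψ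
  · rw [zero_smul]
    by_contra h0
    have := (Finsupp.mem_supported R _).1 (hF ψ) (Finsupp.mem_support_iff.2 (hψ.symm ▸ h0))
    exact hj this

end IsEssentialOverResidueField

section DirectSum

variable {R : Type u} [CommRing R] {E : Type u} [AddCommGroup E] [Module R E] {ι : Type u}
  {M : ι → Type u} [∀ i, AddCommGroup (M i)] [∀ i, Module R (M i)] {r : ι → ℕ}
  (x : ∀ i, Fin (r i) → M i)

/-- The map sending a family of homomorphisms `E → E`, indexed by generators `x i j` of the
modules `M i`, to the induced family of functionals on `Hom(M i, E)`. -/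
def homPiToDoubleDual (E : Type u) [AddCommGroup E] [Module R E] :
    (E →ₗ[R] ((i : ι) × Fin (r i)) → E) →ₗ[R] (∀ i, (M i →ₗ[R] E) →ₗ[R] E) :=
  LinearMap.pi fun i ↦ LinearMap.mk₂ R (fun h ψ ↦ ∑ j, h (ψ (x i j)) ⟨i, j⟩)
    (fun h h' ψ ↦ by simp [Finset.sum_add_distrib]) (fun a h ψ ↦ by simp [Finset.smul_sum])
    (fun h ψ ψ' ↦ by simp [Finset.sum_add_distrib]) (fun a h ψ ↦ by simp [Finset.smul_sum])

lemma homPiToDoubleDual_apply (h : E →ₗ[R] ((i : ι) × Fin (r i)) → E) (i : ι)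
    (ψ : M i →ₗ[R] E) : homPiToDoubleDual x E h i ψ = ∑ j, h (ψ (x i j)) ⟨i, j⟩ := rfl

lemma homPiToDoubleDual_surjective [Module.Injective R E]
    (hx : ∀ i, Submodule.span R (Set.range (x i)) = ⊤) :
    Function.Surjective (homPiToDoubleDual (R := R) x E) := by
  intro w
  let ev (i : ι) : (M i →ₗ[R] E) →ₗ[R] (Fin (r i) → E) :=
    LinearMap.pi fun j ↦ LinearMap.applyₗ (x i j)
  have hev (i : ι) : Function.Injective (ev i) := fun ψ ψ' h ↦
    LinearMap.ext_on_range (hx i) fun j ↦ congrFun h j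
  choose W hW using fun i ↦
    Module.Injective.extension_property R E _ _ (ev i) (hev i) (w i)
  refine ⟨LinearMap.pi fun k ↦ W k.1 ∘ₗ LinearMap.single R (fun _ ↦ E) k.2, ?_⟩
  ext i ψ
  rw [homPiToDoubleDual_apply, ← hW i, LinearMap.comp_apply]
  simp only [LinearMap.pi_apply, LinearMap.comp_apply, LinearMap.single_apply]
  exact (map_sum (W i) _ _).symm.trans (congrArg (W i) (Finset.univ_sum_single (ev i ψ)))

variable (R) in
/-- The element of `⨁ i, M i` with given coefficients on the generators `x i j`. -/
noncomputable def generatorCombination [DecidableEq ι] :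
    (((i : ι) × Fin (r i)) →₀ R) →ₗ[R] Π₀ i, M i :=
  Finsupp.linearCombination R fun k ↦ DFinsupp.lsingle (R := R) k.1 (x k.1 k.2)

lemma generatorCombination_apply [DecidableEq ι] (c : ((i : ι) × Fin (r i)) →₀ R) (i : ι) :
    generatorCombination R x c i = ∑ j, c ⟨i, j⟩ • x i j := by
  induction c using Finsupp.induction_linear with
  | zero => simp
  | add c d hc hd => simp [hc, hd, add_smul, Finset.sum_add_distrib]
  | single k a =>
    obtain ⟨l, j⟩ := k
    rw [generatorCombination, Finsupp.linearCombination_single, DFinsupp.smul_apply,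
      DFinsupp.lsingle_apply, DFinsupp.single_apply]
    split_ifs with h
    · subst h
      simp [Finsupp.single_apply]
    · simp [h]

lemma generatorCombination_mem_smul_top [DecidableEq ι] (I : Ideal R)
    {c : ((i : ι) × Fin (r i)) →₀ R} (hc : ∀ k, c k ∈ I) :
    generatorCombination R x c ∈ (I • ⊤ : Submodule R (Π₀ i, M i)) := by
  rw [generatorCombination, Finsupp.linearCombination_apply]
  exact Submodule.sum_mem _ fun k _ ↦ Submodule.smul_mem_smul (hc k) trivial

/-- `α` is the double duality map with respect to `E` on the `I`-adic completion of `⨁ i, M i`. -/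
def IsCompletionDoubleDual (I : Ideal R)
    (α : AdicCompletion I (Π₀ i, M i) →ₗ[R] ∀ i, (M i →ₗ[R] E) →ₗ[R] E) : Prop :=
  ∀ i z ψ n y, (I ^ n • ⊤ : Submodule R (M i)) ≤ LinearMap.ker ψ →
    AdicCompletion.eval I (Π₀ i, M i) n z = Submodule.mkQ _ y → α z i ψ = ψ (y i)

lemma exists_isCompletionDoubleDual (I : Ideal R)
    (hker : ∀ i (ψ : M i →ₗ[R] E), ∃ n, (I ^ n • ⊤ : Submodule R (M i)) ≤ LinearMap.ker ψ) :
    ∃ α : AdicCompletion I (Π₀ i, M i) →ₗ[R] ∀ i, (M i →ₗ[R] E) →ₗ[R] E,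
      IsCompletionDoubleDual I α := by
  choose α hα using fun i ↦ AdicCompletion.exists_pairing (hker i) (DFinsupp.lapply i)
  exact ⟨LinearMap.pi α, hα⟩

namespace IsCompletionDoubleDual

variable [IsLocalRing R] {s : E}
  {α : AdicCompletion (maximalIdeal R) (Π₀ i, M i) →ₗ[R] ∀ i, (M i →ₗ[R] E) →ₗ[R] E}

lemma injective [Module.Injective R E] (hα : IsCompletionDoubleDual (maximalIdeal R) α)
    (h : IsEssentialOverResidueField (R := R) E s) : Function.Injective α := by
  classical
  refine (injective_iff_map_eq_zero _).2 fun z hz ↦ AdicCompletion.ext fun n ↦ ?_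
  by_contra hne
  obtain ⟨φ, hφ⟩ := h.exists_apply_ne_zero hne
  obtain ⟨y, hy⟩ := Submodule.mkQ_surjective _ (AdicCompletion.eval (maximalIdeal R) _ n z)
  apply hφ
  change φ (AdicCompletion.eval (maximalIdeal R) _ n z) = 0
  rw [← hy, ← LinearMap.comp_apply, ← DFinsupp.sum_single (f := y), DFinsupp.sum, map_sum]
  refine Finset.sum_eq_zero fun i _ ↦ ?_
  refine (hα i z (φ ∘ₗ Submodule.mkQ _ ∘ₗ DFinsupp.lsingle i) n y ?_ hy.symm).symm.trans
    (by rw [hz]; rfl)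
  rw [Submodule.smul_le]
  intro a ha m _
  rw [LinearMap.mem_ker, LinearMap.comp_apply, map_smul, LinearMap.comp_apply, ← map_smul,
    Submodule.mkQ_apply, (Submodule.Quotient.mk_eq_zero _).2
      (Submodule.smul_mem_smul ha Submodule.mem_top), map_zero]

lemma exists_eq_homPiToDoubleDual [IsNoetherianRing R] [Module.Injective R E]
    (hα : IsCompletionDoubleDual (maximalIdeal R) α)
    (h : IsEssentialOverResidueField (R := R) E s)
    (hker : ∀ i (ψ : M i →ₗ[R] E),
      ∃ n, (maximalIdeal R ^ n • ⊤ : Submodule R (M i)) ≤ LinearMap.ker ψ)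
    (g : E →ₗ[R] ((i : ι) × Fin (r i)) →₀ E) :
    ∃ z, α z = homPiToDoubleDual x E (Finsupp.lcoeFun ∘ₗ g) := by
  classical
  choose c hc using h.exists_finsupp_smul_eq g
  let y : AdicCompletion.AdicCauchySequence (maximalIdeal R) (Π₀ i, M i) :=
    AdicCompletion.AdicCauchySequence.mk _ _ (fun n ↦ generatorCombination R x (c n)) fun n ↦ by
      rw [SModEq.sub_mem, ← map_sub]
      refine generatorCombination_mem_smul_top x _ fun k ↦ h.mem_pow_maximalIdeal fun e he ↦ ?_
      rw [Finsupp.sub_apply, sub_smul, ← hc n e he k,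
        ← hc (n + 1) e (fun a ha ↦ he a (Ideal.pow_le_pow_right n.le_succ ha)) k, sub_self]
  refine ⟨AdicCompletion.mk _ _ y, ?_⟩
  ext i ψ
  obtain ⟨n, hn⟩ := hker i ψ
  rw [hα i _ ψ n (generatorCombination R x (c n)) hn rfl, generatorCombination_apply, map_sum,
    homPiToDoubleDual_apply]
  refine Finset.sum_congr rfl fun j _ ↦ ?_
  rw [map_smul]
  refine (hc n _ (fun a ha ↦ ?_) ⟨i, j⟩).symm
  rw [← map_smul]
  exact hn (Submodule.smul_mem_smul ha trivial)

lemma finite_ne_zero [IsNoetherianRing R]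
    (hα : IsCompletionDoubleDual (maximalIdeal R) α)
    (h : IsEssentialOverResidueField (R := R) E s)
    (hπ : ∀ n : ℕ, 1 ≤ n → {i | ¬ ∀ j, ∃ π : M i →ₗ[R] R ⧸ maximalIdeal R ^ n,
      ∀ j', π (x i j') = if j = j' then 1 else 0}.Finite)
    {H : E →ₗ[R] ((i : ι) × Fin (r i)) → E} {z : AdicCompletion (maximalIdeal R) (Π₀ i, M i)}
    (hz : homPiToDoubleDual x E H = α z) (e : E) : {k | H e k ≠ 0}.Finite := by
  classical
  obtain ⟨m, hm⟩ := h.exists_pow_smul_eq_zero e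
  let n := m + 1
  have hn : ∀ a ∈ maximalIdeal R ^ n, a • e = 0 := fun a ha ↦
    hm a (Ideal.pow_le_pow_right m.le_succ ha)
  obtain ⟨y, hy⟩ := Submodule.mkQ_surjective _ (AdicCompletion.eval (maximalIdeal R) _ n z)
  have hfin := (hπ n m.succ_pos).union y.support.finite_toSet
  refine (hfin.preimage' (f := Sigma.fst) fun i _ ↦
    (Set.finite_range (Sigma.mk i)).subset ?_).subset ?_
  · rintro ⟨_, j⟩ rfl
    exact ⟨j, rfl⟩
  rintro ⟨i, j⟩ hij
  by_contra hi
  obtain ⟨hi₁, hi₂⟩ := not_or.1 hi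
  obtain ⟨π, hπj⟩ := not_not.1 hi₁ j
  have hyi : y i = 0 := DFinsupp.notMem_support_iff.1 hi₂
  let θ : (R ⧸ maximalIdeal R ^ n) →ₗ[R] E :=
    (maximalIdeal R ^ n).liftQ (LinearMap.toSpanSingleton R E e) hn
  have hθ : θ 1 = e :=
    (Submodule.liftQ_apply _ _ _).trans (LinearMap.toSpanSingleton_apply_one _ _ _)
  have hψ : (maximalIdeal R ^ n • ⊤ : Submodule R (M i)) ≤ LinearMap.ker (θ ∘ₗ π) := by
    rw [Submodule.smul_le]
    intro a ha v _
    obtain ⟨b, hb⟩ := Submodule.Quotient.mk_surjective _ (π v)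
    rw [LinearMap.mem_ker, LinearMap.comp_apply, map_smul, ← hb, ← Submodule.Quotient.mk_smul,
      smul_eq_mul, (Submodule.Quotient.mk_eq_zero _).2 (Ideal.mul_mem_right b _ ha), map_zero]
  have key := congrArg (fun w ↦ w i (θ ∘ₗ π)) hz
  simp only [homPiToDoubleDual_apply, hα i z (θ ∘ₗ π) n y hψ hy.symm, hyi, map_zero,
    LinearMap.comp_apply, hπj] at key
  apply hij
  rw [Finset.sum_eq_single j] at key
  · simpa [hθ] using key
  · intro j' _ hj'
    simp [hj'.symm]
  · simp

end IsCompletionDoubleDual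

end DirectSum

/-- If all `M i` are finitely generated and for each `n ≥ 1` the quotient
`M i/𝔪^n M i` is a free `R/𝔪^n`-module for all but finitely many `i`, then the completion
of `⊕ M i` is pure-injective. -/
theorem completion_sum_pureInjective (R : Type u) [CommRing R] [IsNoetherianRing R]
    [IsLocalRing R] {ι : Type u} (M : ι → Type u)
    [∀ i, AddCommGroup (M i)] [∀ i, Module R (M i)] [∀ i, Module.Finite R (M i)]
    (hfree : ∀ n : ℕ, 1 ≤ n →
      {i : ι | ¬ ∃ κ : Type u, Nonempty
        ((M i ⧸ (maximalIdeal R ^ n • ⊤ : Submodule R (M i))) ≃ₗ[R]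
          (κ →₀ R ⧸ (maximalIdeal R ^ n)))}.Finite) :
    IsPureInjective R (AdicCompletion (maximalIdeal R) (Π₀ i, M i)) := by
  intro Y _ _ f hf
  obtain ⟨E, _, _, s, _, hE⟩ := exists_isEssentialOverResidueField_injective R
  have hker (i : ι) (ψ : M i →ₗ[R] E) :
      ∃ n, (maximalIdeal R ^ n • ⊤ : Submodule R (M i)) ≤ LinearMap.ker ψ :=
    LinearMap.exists_pow_smul_top_le_ker _ hE.exists_pow_smul_eq_zero ψ
  obtain ⟨α, hα⟩ := exists_isCompletionDoubleDual (maximalIdeal R) hker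
  choose r x hx hπ using fun i ↦ exists_span_and_coordinates R (M i)
  have hπ' (n : ℕ) (hn : 1 ≤ n) : {i | ¬ ∀ j, ∃ π : M i →ₗ[R] R ⧸ maximalIdeal R ^ n,
      ∀ j', π (x i j') = if j = j' then 1 else 0}.Finite :=
    (hfree n hn).subset fun i hi hi' ↦ hi (hπ i n hn hi')
  obtain ⟨σ, hσ⟩ := exists_finsupp_retraction (R := R) E ((i : ι) × Fin (r i))
  obtain ⟨β, hβ⟩ := exists_leftInverse_of_surjective α (hα.injective hE)
    (homPiToDoubleDual x E) (homPiToDoubleDual_surjective x hx)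
    (LinearMap.compRight R (Finsupp.lcoeFun ∘ₗ σ))
    (fun H ↦ hα.exists_eq_homPiToDoubleDual x hE hker (σ ∘ₗ H))
    (fun H z hz ↦ congrArg _ (LinearMap.ext fun e ↦ by
      have hfin := hα.finite_ne_zero x hE hπ' hz e
      have := hσ (Finsupp.ofSupportFinite (H e) hfin)
      exact congrArg DFunLike.coe this))
  choose G hG using fun i ↦ hf.exists_extension_hom (M i →ₗ[R] E) E (LinearMap.proj i ∘ₗ α)
  refine ⟨β ∘ₗ LinearMap.pi G, ?_⟩
  rw [← hβ, LinearMap.comp_assoc]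
  congr 1
  exact LinearMap.ext fun z ↦ funext fun i ↦ LinearMap.congr_fun (hG i) z
end
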